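/- arXiv:2106.01930 — 5 statements merged into one kernel-verified Lean document; each statement's English description precedes it below -/
import Mathlib

section
/- Let T : R^n → R^n be a piecewise affine Shapley operator. Then the mean payoff vector χ(T) = lim_{k→∞} T^k(0)/k exists, and T admits a finite eigenvector if and only if χ_i(T) is independent of i ∈ [n], i.e., χ(T) is a constant vector. -/
open scoped Classical BigOperators

noncomputable section

namespace TropReg

/-- A (convex) polyhedron of `ℝ^n`: finite intersection of affine half-spaces. -/
def IsPolyhedron {n : ℕ} (P : Set (Fin n → ℝ)) : Prop :=
  ∃ (m : ℕ) (c : Fin m → Fin n → ℝ) (b : Fin m → ℝ),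
    P = { x | ∀ j, (∑ i, c j i * x i) ≤ b j }

/-- `T : ℝ^n → ℝ^n` is piecewise affine: `ℝ^n` is covered by finitely many polyhedra
on each of which every coordinate of `T` is affine. -/
def IsPWAffineR {n : ℕ} (T : (Fin n → ℝ) → (Fin n → ℝ)) : Prop :=
  ∃ (m : ℕ) (P : Fin m → Set (Fin n → ℝ)),
    (∀ s, IsPolyhedron (P s)) ∧ (⋃ s, P s) = Set.univ ∧
    ∀ s, ∀ i : Fin n, ∃ (c : Fin n → ℝ) (b : ℝ), ∀ x ∈ P s,
      T x i = (∑ j, c j * x j) + b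

open Filter Topology Matrix

/-- A bounded solution `z` of `q(a) z(a) = p(a)` along a filter tending to `0` coincides with
a function differentiable at `0`. -/
lemma exists_hasDerivAt_of_bounded_quotient {l : Filter ℝ} [l.NeBot] (hl : l ≤ 𝓝[>] 0)
    {z : ℝ → ℝ} {K : ℝ} (hz : ∀ᶠ a in l, |z a| ≤ K) (q p : Polynomial ℝ) (hq : q ≠ 0)
    (h : ∀ᶠ a in l, q.eval a * z a = p.eval a) :
    ∃ (r : ℝ → ℝ) (r' : ℝ), HasDerivAt r r' 0 ∧ ∀ᶠ a in l, z a = r a := by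
  have hl0 : l ≤ 𝓝 0 := hl.trans nhdsWithin_le_nhds
  have hpos : ∀ᶠ a in l, (0 : ℝ) < a := hl self_mem_nhdsWithin
  induction hd : q.natDegree generalizing q p with
  | zero =>
    obtain ⟨c, rfl⟩ := Polynomial.natDegree_eq_zero.1 hd
    have hc : c ≠ 0 := by rintro rfl; simp at hq
    refine ⟨fun a => c⁻¹ * p.eval a, _, (p.hasDerivAt 0).const_mul _, ?_⟩
    filter_upwards [h] with a ha
    rw [← ha, Polynomial.eval_C, inv_mul_cancel_left₀ hc]
  | succ d ih =>
    by_cases hq0 : q.eval 0 = 0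
    · have hp0 : p.eval 0 = 0 := by
        have h1 : Tendsto (fun a => p.eval a) l (𝓝 (p.eval 0)) :=
          (p.continuous.tendsto 0).mono_left hl0
        have h2 : Tendsto (fun a => q.eval a) l (𝓝 0) := by
          have := (q.continuous.tendsto 0).mono_left hl0
          rwa [hq0] at this
        have h3 : Tendsto (fun a => q.eval a * z a) l (𝓝 0) :=
          h2.zero_mul_isBoundedUnder_le ⟨K, by simpa using hz⟩
        exact tendsto_nhds_unique h1 (h3.congr' h)
      obtain ⟨q', rfl⟩ := Polynomial.X_dvd_iff.2 ((Polynomial.coeff_zero_eq_eval_zero q).trans hq0)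
      obtain ⟨p', rfl⟩ := Polynomial.X_dvd_iff.2 ((Polynomial.coeff_zero_eq_eval_zero p).trans hp0)
      have hq' : q' ≠ 0 := by rintro rfl; simp at hq
      refine ih q' p' hq' ?_ ?_
      · filter_upwards [h, hpos] with a ha hap
        simp only [Polynomial.eval_mul, Polynomial.eval_X, mul_assoc] at ha
        exact mul_left_cancel₀ hap.ne' ha
      · rw [Polynomial.natDegree_X_mul hq'] at hd
        omega
    · refine ⟨fun a => p.eval a / q.eval a, _, (p.hasDerivAt 0).div (q.hasDerivAt 0) hq0, ?_⟩
      have hne : ∀ᶠ a in l, q.eval a ≠ 0 :=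
        hl0 ((q.continuous.tendsto 0).eventually_ne hq0)
      filter_upwards [h, hne] with a ha hqa
      rw [eq_div_iff hqa, mul_comm, ha]

/-- Solutions of the discounted affine equation `x = A ((1 - a) x) + b` with `a x` bounded have
an expansion `x = v / a + u + o(1)` as the discount `a` tends to zero. -/
lemma exists_expansion_of_affine {n : ℕ} {l : Filter ℝ} [l.NeBot] (hl : l ≤ 𝓝[>] 0)
    {x : ℝ → Fin n → ℝ} {K : ℝ} (hx : ∀ᶠ a in l, ‖a • x a‖ ≤ K)
    (A : Matrix (Fin n) (Fin n) ℝ) (b : Fin n → ℝ)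
    (h : ∀ᶠ a in l, x a = A *ᵥ ((1 - a) • x a) + b) :
    ∃ u v : Fin n → ℝ, Tendsto (fun a => a • x a) l (𝓝 v) ∧
      Tendsto (fun a => x a - a⁻¹ • v) l (𝓝 u) := by
  have hl0 : l ≤ 𝓝 0 := hl.trans nhdsWithin_le_nhds
  have hpos : ∀ᶠ a in l, (0 : ℝ) < a := hl self_mem_nhdsWithin
  let M : Matrix (Fin n) (Fin n) (Polynomial ℝ) :=
    1 - (1 - Polynomial.X : Polynomial ℝ) • A.map Polynomial.C
  have hM : ∀ a : ℝ, (Polynomial.evalRingHom a).mapMatrix M = 1 - (1 - a) • A := by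
    intro a
    ext i j
    by_cases hij : i = j <;> simp [M, hij]
  have hdet : M.det ≠ 0 := by
    intro h0
    have h1 := congrArg (Polynomial.evalRingHom (1 : ℝ)) h0
    rw [RingHom.map_det, hM] at h1
    simp at h1
  have key : ∀ i, ∃ (r : ℝ → ℝ) (r' : ℝ), HasDerivAt r r' 0 ∧
      ∀ᶠ a in l, (a • x a) i = r a := by
    intro i
    refine exists_hasDerivAt_of_bounded_quotient (K := K) hl ?_ M.det
      (Polynomial.X * ∑ j, M.adjugate i j * Polynomial.C (b j)) hdet ?_
    · filter_upwards [hx] with a ha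
      exact (norm_le_pi_norm (a • x a) i).trans ha
    · filter_upwards [h] with a ha
      have h1 : (1 - (1 - a) • A) *ᵥ x a = b := by
        rw [Matrix.sub_mulVec, Matrix.one_mulVec, Matrix.smul_mulVec, ← Matrix.mulVec_smul]
        exact sub_eq_of_eq_add' ha
      have hd : M.det.eval a = (1 - (1 - a) • A).det := by
        rw [← hM a, ← RingHom.map_det]; rfl
      have hadj : ∀ j, (M.adjugate i j).eval a = (1 - (1 - a) • A).adjugate i j := by
        intro j
        rw [← hM a, ← RingHom.map_adjugate]; rfl
      have h2 := congrFun (congrArg ((1 - (1 - a) • A).adjugate *ᵥ ·) h1) i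
      simp only [Matrix.mulVec_mulVec, Matrix.adjugate_mul, Matrix.smul_mulVec,
        Matrix.one_mulVec, Pi.smul_apply, smul_eq_mul] at h2
      simp only [Polynomial.eval_mul, Polynomial.eval_X, Polynomial.eval_finsetSum,
        Polynomial.eval_C, hd, hadj, Pi.smul_apply, smul_eq_mul]
      rw [mul_left_comm, h2]
      rfl
  choose r r' hr hxr using key
  refine ⟨r', fun i => r i 0, tendsto_pi_nhds.2 fun i => ?_, tendsto_pi_nhds.2 fun i => ?_⟩
  · exact (((hr i).continuousAt.tendsto).mono_left hl0).congr' ((hxr i).mono fun a ha => ha.symm)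
  · have h1 := ((hr i).tendsto_slope).mono_left
      (hl.trans (nhdsWithin_mono _ fun a (ha : 0 < a) => ha.ne'))
    refine h1.congr' ?_
    filter_upwards [hxr i, hpos] with a ha hap
    have hap' := hap.ne'
    simp only [Pi.smul_apply, smul_eq_mul] at ha
    simp only [slope_def_field, Pi.sub_apply, Pi.smul_apply, smul_eq_mul, sub_zero, ← ha]
    field_simp

/-- If `y = v / a + w + o(1)` stays in a half-space, the half-line `w + t v` is eventually in it. -/
lemma eventually_halfLine_le {n : ℕ} {l : Filter ℝ} [l.NeBot] (hl : l ≤ 𝓝[>] 0)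
    {y : ℝ → Fin n → ℝ} {w v : Fin n → ℝ} (hv : Tendsto (fun a => a • y a) l (𝓝 v))
    (hw : Tendsto (fun a => y a - a⁻¹ • v) l (𝓝 w)) (c : Fin n → ℝ) (b : ℝ)
    (h : ∀ᶠ a in l, c ⬝ᵥ y a ≤ b) :
    ∀ᶠ t : ℝ in atTop, c ⬝ᵥ (w + t • v) ≤ b := by
  have hl0 : l ≤ 𝓝 0 := hl.trans nhdsWithin_le_nhds
  have hpos : ∀ᶠ a in l, (0 : ℝ) < a := hl self_mem_nhdsWithin
  have hcont : Continuous fun z : Fin n → ℝ => c ⬝ᵥ z := by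
    unfold dotProduct; fun_prop
  have hcv : c ⬝ᵥ v ≤ 0 := by
    have h1 : Tendsto (fun a : ℝ => a * b) l (𝓝 0) := by
      simpa using (tendsto_id.mono_left hl0 : Tendsto id l (𝓝 (0 : ℝ))).mul_const b
    refine le_of_tendsto_of_tendsto ((hcont.tendsto v).comp hv) h1 ?_
    filter_upwards [h, hpos] with a ha hap
    simp only [Function.comp, dotProduct_smul, smul_eq_mul]
    exact mul_le_mul_of_nonneg_left ha hap.le
  simp only [dotProduct_add, dotProduct_smul, smul_eq_mul]
  rcases hcv.lt_or_eq with hlt | heq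
  · exact (tendsto_atBot_add_const_left _ _
      (tendsto_id.atTop_mul_const_of_neg hlt)).eventually_le_atBot b
  · have hcw : c ⬝ᵥ w ≤ b := by
      refine le_of_tendsto ((hcont.tendsto w).comp hw) ?_
      filter_upwards [h] with a ha
      simpa [Function.comp, dotProduct_sub, dotProduct_smul, heq] using ha
    exact Eventually.of_forall fun t => by simpa [heq] using hcw

/-- Order preserving, additively homogeneous maps are nonexpansive in the sup-norm. -/
lemma lipschitzWith_one_of_monotone_of_homogeneous {n : ℕ} {T : (Fin n → ℝ) → (Fin n → ℝ)}
    (hmono : Monotone T)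
    (hhom : ∀ (α : ℝ) (x : Fin n → ℝ), T (fun i => α + x i) = fun i => α + T x i) :
    LipschitzWith 1 T := by
  have aux : ∀ x y i, T x i ≤ dist x y + T y i := by
    intro x y i
    rw [← congrFun (hhom (dist x y) y) i]
    refine hmono (fun j => ?_) i
    have := (le_abs_self _).trans (dist_le_pi_dist x y j)
    linarith
  refine LipschitzWith.of_dist_le_mul fun x y => ?_
  rw [NNReal.coe_one, one_mul, dist_pi_le_iff dist_nonneg]
  intro i
  rw [Real.dist_eq, abs_le]
  have h1 := aux x y i
  have h2 := aux y x i
  rw [dist_comm y x] at h2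
  constructor <;> linarith

/-- A nonexpansive map has, for every discount `a ∈ (0, 1]`, a discounted fixed point `x`, and
`a x` is bounded independently of `a`. -/
lemma exists_discounted_fixedPoint {n : ℕ} {T : (Fin n → ℝ) → (Fin n → ℝ)}
    (hT : LipschitzWith 1 T) {a : ℝ} (ha : 0 < a) (ha1 : a ≤ 1) :
    ∃ x, x = T ((1 - a) • x) ∧ ‖a • x‖ ≤ ‖T 0‖ := by
  have hc : ContractingWith (Real.toNNReal (1 - a)) fun x => T ((1 - a) • x) := by
    refine ⟨by rw [Real.toNNReal_lt_one]; linarith, LipschitzWith.of_dist_le_mul fun x y => ?_⟩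
    have h1 := hT.dist_le_mul ((1 - a) • x) ((1 - a) • y)
    rw [NNReal.coe_one, one_mul, dist_smul₀, Real.norm_of_nonneg (by linarith)] at h1
    rwa [Real.coe_toNNReal (1 - a) (by linarith)]
  refine ⟨hc.fixedPoint, hc.fixedPoint_isFixedPt.symm, ?_⟩
  set x := hc.fixedPoint
  have hx : x = T ((1 - a) • x) := hc.fixedPoint_isFixedPt.symm
  have h1 : ‖x‖ ≤ (1 - a) * ‖x‖ + ‖T 0‖ := by
    calc ‖x‖ = ‖(T ((1 - a) • x) - T 0) + T 0‖ := by rw [sub_add_cancel, ← hx]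
      _ ≤ ‖T ((1 - a) • x) - T 0‖ + ‖T 0‖ := norm_add_le _ _
      _ ≤ (1 - a) * ‖x‖ + ‖T 0‖ := by
        have h2 := hT.dist_le_mul ((1 - a) • x) 0
        rw [NNReal.coe_one, one_mul, dist_eq_norm, dist_zero_right, norm_smul,
          Real.norm_of_nonneg (by linarith)] at h2
        linarith
  rw [norm_smul, Real.norm_of_nonneg ha.le]
  linarith

/-- Kohlberg's theorem: a nonexpansive piecewise affine map has an invariant half-line. -/
lemma exists_invariant_halfLine {n : ℕ} {T : (Fin n → ℝ) → (Fin n → ℝ)}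
    (hT : LipschitzWith 1 T) (hpw : IsPWAffineR T) :
    ∃ u v : Fin n → ℝ, ∀ᶠ t : ℝ in atTop, T (u + t • v) = u + (t + 1) • v := by
  obtain ⟨m, P, hP, hcover, haff⟩ := hpw
  have hex : ∀ a : ℝ, ∃ x, 0 < a → a ≤ 1 → x = T ((1 - a) • x) ∧ ‖a • x‖ ≤ ‖T 0‖ := by
    intro a
    by_cases h : 0 < a ∧ a ≤ 1
    · obtain ⟨x, hx⟩ := exists_discounted_fixedPoint hT h.1 h.2
      exact ⟨x, fun _ _ => hx⟩
    · exact ⟨0, fun h1 h2 => absurd ⟨h1, h2⟩ h⟩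
  choose x hx using hex
  let l : Ultrafilter ℝ := Ultrafilter.of (𝓝[>] (0 : ℝ))
  have hl : (l : Filter ℝ) ≤ 𝓝[>] 0 := Ultrafilter.of_le _
  have hl0 : (l : Filter ℝ) ≤ 𝓝 0 := hl.trans nhdsWithin_le_nhds
  have hpos : ∀ᶠ a in (l : Filter ℝ), (0 : ℝ) < a := hl self_mem_nhdsWithin
  have hle : ∀ᶠ a in (l : Filter ℝ), a ≤ (1 : ℝ) := hl0 (Iic_mem_nhds one_pos)
  obtain ⟨s, hs⟩ : ∃ s, ∀ᶠ a in (l : Filter ℝ), (1 - a) • x a ∈ P s := by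
    refine Ultrafilter.eventually_exists_iff.1 (Eventually.of_forall fun a => ?_)
    exact Set.mem_iUnion.1 (hcover ▸ Set.mem_univ _)
  choose A b hAb using haff s
  have hA : ∀ z ∈ P s, T z = Matrix.of A *ᵥ z + b := fun z hz => funext fun i => hAb i z hz
  have hfix : ∀ᶠ a in (l : Filter ℝ), x a = Matrix.of A *ᵥ ((1 - a) • x a) + b := by
    filter_upwards [hpos, hle, hs] with a h1 h2 h3
    rw [← hA _ h3]
    exact (hx a h1 h2).1
  obtain ⟨u, v, hv, hu⟩ := exists_expansion_of_affine hl
    (hpos.and hle |>.mono fun a h => (hx a h.1 h.2).2) (Matrix.of A) b hfix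
  have hid : Tendsto (fun a : ℝ => 1 - a) l (𝓝 1) := by
    simpa using (tendsto_const_nhds (x := (1 : ℝ))).sub (tendsto_id.mono_left hl0)
  have hyv : Tendsto (fun a => a • ((1 - a) • x a)) l (𝓝 v) := by
    have := hid.smul hv
    rw [one_smul] at this
    exact this.congr fun a => smul_comm _ _ _
  have hyu : Tendsto (fun a => (1 - a) • x a - a⁻¹ • v) l (𝓝 (u - v)) :=
    (hu.sub hv).congr fun a => by rw [sub_smul, one_smul]; abel
  have hcont : Continuous fun z : Fin n → ℝ => Matrix.of A *ᵥ z :=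
    continuous_const.matrix_mulVec continuous_id
  have hAv : Matrix.of A *ᵥ v = v := by
    have h1 : Tendsto (fun a : ℝ => a • b) l (𝓝 0) := by
      simpa using (tendsto_id.mono_left hl0 : Tendsto id (l : Filter ℝ) (𝓝 (0 : ℝ))).smul_const b
    have h2 := ((hcont.tendsto v).comp hyv).add h1
    rw [add_zero] at h2
    refine tendsto_nhds_unique h2 (hv.congr' ?_)
    filter_upwards [hfix] with a ha
    conv_lhs => rw [ha]
    simp only [Function.comp, smul_add, Matrix.mulVec_smul]
  have hAu : Matrix.of A *ᵥ u + b = u + v := by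
    have h2 := ((hcont.tendsto _).comp hyu).add_const b
    have h3 : Matrix.of A *ᵥ (u - v) + b = u := by
      refine tendsto_nhds_unique h2 (hu.congr' ?_)
      filter_upwards [hfix] with a ha
      conv_lhs => rw [ha]
      simp only [Function.comp, Matrix.mulVec_sub, Matrix.mulVec_smul, hAv]
      abel
    rw [Matrix.mulVec_sub, hAv] at h3
    rw [← sub_eq_iff_eq_add, add_sub_right_comm]
    exact h3
  refine ⟨u, v, ?_⟩
  obtain ⟨k, c, d, hPs⟩ := hP s
  have hmem : ∀ᶠ t : ℝ in atTop, (u - v) + t • v ∈ P s := by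
    rw [hPs]
    refine eventually_all.2 fun j => eventually_halfLine_le hl hyv hyu (c j) (d j) ?_
    filter_upwards [hs] with a ha
    rw [hPs] at ha
    exact ha j
  filter_upwards [(tendsto_atTop_add_const_right atTop (1 : ℝ) tendsto_id).eventually hmem]
    with t ht
  have hut : u - v + (id t + 1) • v = u + t • v := by
    rw [id, add_smul, one_smul]; abel
  rw [hut] at ht
  rw [hA _ ht, Matrix.mulVec_add, Matrix.mulVec_smul, hAv, add_right_comm, hAu, add_smul,
    one_smul]
  abel

/-- The orbits of a nonexpansive map all have the same linear growth rate. -/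
lemma tendsto_iterate_zero_div {n : ℕ} {T : (Fin n → ℝ) → (Fin n → ℝ)} (hT : LipschitzWith 1 T)
    {w v : Fin n → ℝ} (h : ∀ k : ℕ, T^[k] w = w + (k : ℝ) • v) (i : Fin n) :
    Tendsto (fun k : ℕ => T^[k] 0 i / (k : ℝ)) atTop (𝓝 (v i)) := by
  rw [tendsto_iff_norm_sub_tendsto_zero]
  refine squeeze_zero' (Eventually.of_forall fun _ => norm_nonneg _) ?_
    (tendsto_const_div_atTop_nhds_zero_nat (2 * ‖w‖))
  filter_upwards [eventually_gt_atTop 0] with k hk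
  have hk' : (0 : ℝ) < k := Nat.cast_pos.2 hk
  have h1 : |T^[k] 0 i - (w i + k * v i)| ≤ ‖w‖ := by
    have h2 := (hT.iterate k).dist_le_mul 0 w
    simp only [one_pow, NNReal.coe_one, one_mul, dist_zero_left] at h2
    have h3 := (dist_le_pi_dist (T^[k] 0) (T^[k] w) i).trans h2
    rwa [h k] at h3
  have h4 : |w i| ≤ ‖w‖ := norm_le_pi_norm w i
  rw [Real.norm_eq_abs, le_div_iff₀ hk', ← abs_of_pos hk', ← abs_mul, abs_of_pos hk', sub_mul,
    div_mul_cancel₀ _ hk'.ne']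
  rw [abs_le] at *
  constructor <;> linarith

/-- For a piecewise affine Shapley operator `T : ℝ^n → ℝ^n`
(order preserving and additively homogeneous), the mean payoff vector
`χ(T) = lim_k T^k(0)/k` exists, and `T` admits a finite eigenvector if and only if
`χ(T)` is a constant vector. -/
theorem stmt1 {n : ℕ} (T : (Fin n → ℝ) → (Fin n → ℝ))
    (hmono : Monotone T)
    (hhom : ∀ (α : ℝ) (x : Fin n → ℝ), T (fun i => α + x i) = fun i => α + T x i)
    (hpw : IsPWAffineR T) :
    ∃ chi : Fin n → ℝ,
      (∀ i, Filter.Tendsto (fun k : ℕ => (T^[k] 0 i) / (k : ℝ))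
        Filter.atTop (nhds (chi i))) ∧
      ((∃ (u : Fin n → ℝ) (lam : ℝ), T u = fun i => lam + u i) ↔
        (∃ c : ℝ, chi = fun _ => c)) := by
  have hT := lipschitzWith_one_of_monotone_of_homogeneous hmono hhom
  obtain ⟨u, v, huv⟩ := exists_invariant_halfLine hT hpw
  obtain ⟨t, ht⟩ := eventually_atTop.1 huv
  have hlim : ∀ i, Tendsto (fun k : ℕ => T^[k] 0 i / (k : ℝ)) atTop (𝓝 (v i)) := by
    refine tendsto_iterate_zero_div hT (w := u + t • v) fun k => ?_
    induction k with
    | zero => simp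
    | succ k ih =>
      rw [Function.iterate_succ_apply', ih, add_assoc, ← add_smul,
        ht _ (le_add_of_nonneg_right k.cast_nonneg), add_assoc u, ← add_smul, Nat.cast_succ,
        add_assoc]
  refine ⟨v, hlim, ?_, ?_⟩
  · rintro ⟨w, lam, hw⟩
    refine ⟨lam, funext fun i => tendsto_nhds_unique (hlim i) ?_⟩
    refine tendsto_iterate_zero_div hT (w := w) (v := fun _ => lam) (fun k => ?_) i
    induction k with
    | zero => simp
    | succ k ih =>
      have h1 : w + (k : ℝ) • (fun _ => lam) = fun i => k * lam + w i := by
        ext i; simp [add_comm]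
      rw [Function.iterate_succ_apply', ih, h1, hhom, hw]
      ext i
      simp only [Pi.add_apply, Pi.smul_apply, smul_eq_mul, Nat.cast_succ]
      ring
  · rintro ⟨c, rfl⟩
    refine ⟨u + t • fun _ => c, c, ?_⟩
    rw [ht t le_rfl]
    ext i
    simp only [Pi.add_apply, Pi.smul_apply, smul_eq_mul]
    ring

end TropReg
end
end

section
/- For all λ ∈ [−∞, 0] and all a ∈ R^n, the Hilbert ball B(−a, −λ) is contained in Col(V) if and only if T(a) ≤ λ + a (entrywise in (Rmax)^n). -/
open scoped Classical BigOperators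

noncomputable section

namespace TropReg

/-- `x` is a vector of `Rmax = ℝ ∪ {-∞}`, modeled inside `EReal` as having no `+∞` entry. -/
def IsRmax {n : ℕ} (x : Fin n → EReal) : Prop := ∀ i, x i ≠ ⊤

/-- Embedding of a real vector into `(Rmax)^n`. -/
def ofReal {n : ℕ} (a : Fin n → ℝ) : Fin n → EReal := fun i => (a i : EReal)

/-- Hilbert's projective metric on `(Rmax)^n`, with values in `[0,+∞] ⊆ EReal`;
`d(⊥,⊥) = 0` by convention, and the infimum of the empty set is `+∞`. -/
def hd {n : ℕ} (x y : Fin n → EReal) : EReal :=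
  if x = ⊥ ∧ y = ⊥ then 0
  else sInf { t : EReal | ∃ lam mu : ℝ, t = (lam : EReal) - (mu : EReal) ∧
        (∀ i, (mu : EReal) + y i ≤ x i) ∧ (∀ i, x i ≤ (lam : EReal) + y i) }

/-- Closed Hilbert ball of center `a` and radius `r`, inside `(Rmax)^n`. -/
def ball {n : ℕ} (a : Fin n → EReal) (r : EReal) : Set (Fin n → EReal) :=
  { x | IsRmax x ∧ hd a x ≤ r }

/-- Hilbert distance from a point to a set. -/
def distPt {n : ℕ} (x : Fin n → EReal) (B : Set (Fin n → EReal)) : EReal :=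
  ⨅ b ∈ B, hd x b

/-- One-sided Hausdorff distance from `A` to `B` for Hilbert's metric. -/
def distHS {n : ℕ} (A B : Set (Fin n → EReal)) : EReal :=
  ⨆ a ∈ A, distPt a B

/-- Tropical hyperplane associated with `a`: the maximum `max_i (a_i + x_i)` is
attained at least twice. -/
def hyper {n : ℕ} (a : Fin n → EReal) : Set (Fin n → EReal) :=
  { x | IsRmax x ∧ ∃ i j : Fin n, i ≠ j ∧
      a i + x i = (⨆ k, a k + x k) ∧ a j + x j = (⨆ k, a k + x k) }

/-- Tropical column space of the matrix `V`. -/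
def colSpace {n p : ℕ} (V : Fin n → Fin p → EReal) : Set (Fin n → EReal) :=
  { y | ∃ x : Fin p → EReal, IsRmax x ∧ y = fun i => ⨆ k, (V i k + x k) }

/-- The `k`-th column of `V`. -/
def col {n p : ℕ} (V : Fin n → Fin p → EReal) (k : Fin p) : Fin n → EReal :=
  fun i => V i k

/-- The set of columns of `V`. -/
def cols {n p : ℕ} (V : Fin n → Fin p → EReal) : Set (Fin n → EReal) :=
  Set.range (col V)

/-- The Shapley operator associated with the matrix `V`. -/
def TV {n p : ℕ} (V : Fin n → Fin p → EReal) (x : Fin n → EReal) : Fin n → EReal :=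
  fun i => ⨅ k ∈ { k : Fin p | V i k ≠ ⊥ },
    (-(V i k) + ⨆ j ∈ { j : Fin n | j ≠ i }, (V j k + x j))

/-- Tropical spectral radius of an operator `T`. -/
def rho {n : ℕ} (T : (Fin n → EReal) → (Fin n → EReal)) : EReal :=
  sSup { lam : EReal | lam ≠ ⊤ ∧ ∃ u : Fin n → EReal, IsRmax u ∧ u ≠ ⊥ ∧
      T u = fun i => lam + u i }

/-- Tropical convex cone in `(Rmax)^n`. -/
def IsTropCone {n : ℕ} (C : Set (Fin n → EReal)) : Prop :=
  (∀ x ∈ C, ∀ y ∈ C, (fun i => x i ⊔ y i) ∈ C) ∧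
  (∀ x ∈ C, ∀ lam : EReal, lam ≠ ⊤ → (fun i => lam + x i) ∈ C)

/-- Tropical span: smallest tropical cone containing `Vs`. -/
def span {n : ℕ} (Vs : Set (Fin n → EReal)) : Set (Fin n → EReal) :=
  ⋂₀ { C | IsTropCone C ∧ Vs ⊆ C }

/-- Inner radius: supremum of radii of Hilbert balls centered at finite points
included in `W`. -/
def inradius {n : ℕ} (W : Set (Fin n → EReal)) : EReal :=
  sSup { r : EReal | ∃ s : ℝ, r = (s : EReal) ∧ 0 ≤ s ∧
      ∃ a : Fin n → ℝ, ball (ofReal a) r ⊆ W }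


/-- Tropical residuation: `x` lies in the column space iff each of its entries is attained by
a multiple of some column lying below `x`. -/
lemma mem_colSpace_iff {n p : ℕ} {V : Fin n → Fin p → EReal} (hVtop : ∀ i k, V i k ≠ ⊤)
    (hrow : ∀ i, ∃ k, V i k ≠ ⊥) {x : Fin n → EReal} (hx : IsRmax x) :
    x ∈ colSpace V ↔ ∀ i, ∃ k, V i k ≠ ⊥ ∧ ∀ j, V j k + (x i - V i k) ≤ x j := by
  constructor
  · rintro ⟨u, hu, rfl⟩ i
    obtain ⟨k₀, hk₀⟩ := hrow i
    by_cases hbot : (⨆ k, (V i k + u k)) = ⊥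
    · exact ⟨k₀, hk₀, fun j => by simp [hbot]⟩
    have : Nonempty (Fin p) := ⟨k₀⟩
    obtain ⟨k, hk⟩ := exists_eq_ciSup_of_finite (f := fun k => V i k + u k)
    rw [← hk, EReal.add_eq_bot_iff, not_or] at hbot
    refine ⟨k, hbot.1, fun j => ?_⟩
    have hcancel : V i k + u k - V i k = u k := by
      lift V i k to ℝ using ⟨hVtop i k, hbot.1⟩ with v
      lift u k to ℝ using ⟨hu k, hbot.2⟩ with w
      norm_cast
      ring
    simp only [← hk, hcancel]
    exact le_iSup (fun k => V j k + u k) k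
  · intro h
    choose κ hκ hle using h
    have hfin (i : Fin n) : x i - V i (κ i) ≠ ⊤ := by
      have hxi := hx i
      lift V i (κ i) to ℝ using ⟨hVtop i _, hκ i⟩ with v
      induction hxv : x i with
      | bot => simp
      | coe r => exact EReal.coe_ne_top (r - v)
      | top => exact absurd hxv hxi
    let u : Fin p → EReal := fun k =>
      (Finset.univ.filter fun i => κ i = k).sup fun i => x i - V i (κ i)
    refine ⟨u, fun k => ne_of_lt ?_, funext fun j => le_antisymm ?_ (iSup_le fun k => ?_)⟩
    · exact (Finset.sup_lt_iff bot_lt_top).2 fun i _ => (hfin i).lt_top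
    · refine le_trans ?_ (le_iSup (fun k => V j k + u k) (κ j))
      calc x j ≤ V j (κ j) + (x j - V j (κ j)) := by
            lift V j (κ j) to ℝ using ⟨hVtop j _, hκ j⟩ with v
            induction x j with
            | bot => exact bot_le
            | coe r => norm_cast; linarith
            | top => simp
        _ ≤ V j (κ j) + u (κ j) := by
            gcongr
            exact Finset.le_sup (f := fun i => x i - V i (κ i)) (by simp)
    · by_cases hne : (Finset.univ.filter fun i => κ i = k).Nonempty
      · obtain ⟨i, hi, hiu⟩ := Finset.exists_mem_eq_sup _ hne fun i => x i - V i (κ i)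
        obtain rfl : κ i = k := by simpa using hi
        exact (congrArg (V j (κ i) + ·) hiu).trans_le (hle i j)
      · have : u k = ⊥ := by simp [u, Finset.not_nonempty_iff_eq_empty.1 hne]
        simp [this]

lemma TV_le_iff {n p : ℕ} {V : Fin n → Fin p → EReal} (hVtop : ∀ i k, V i k ≠ ⊤)
    {x : Fin n → EReal} {i : Fin n} (hrow : ∃ k, V i k ≠ ⊥) {c : EReal} :
    TV V x i ≤ c ↔ ∃ k, V i k ≠ ⊥ ∧ ∀ j, j ≠ i → V j k + x j ≤ c + V i k := by
  have key (k : Fin p) (hk : V i k ≠ ⊥) :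
      -(V i k) + (⨆ j ∈ { j : Fin n | j ≠ i }, (V j k + x j)) ≤ c ↔
        ∀ j, j ≠ i → V j k + x j ≤ c + V i k := by
    rw [add_comm, ← sub_eq_add_neg,
      EReal.sub_le_iff_le_add (.inl hk) (.inl (hVtop i k))]
    simp
  constructor
  · intro h
    obtain ⟨k, hk, hmin⟩ := Set.exists_min_image { k : Fin p | V i k ≠ ⊥ }
      (fun k => -(V i k) + ⨆ j ∈ { j : Fin n | j ≠ i }, (V j k + x j))
      (Set.toFinite _) hrow
    exact ⟨k, hk, (key k hk).1 ((le_iInf₂ hmin).trans h)⟩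
  · rintro ⟨k, hk, h⟩
    exact (iInf₂_le k hk).trans ((key k hk).2 h)

lemma hd_ofReal_ofReal_le {n : ℕ} {b y : Fin n → ℝ} {l m : ℝ} (hm : ∀ i, m + y i ≤ b i)
    (hl : ∀ i, b i ≤ l + y i) (hml : m ≤ l) :
    hd (ofReal b) (ofReal y) ≤ ((l - m : ℝ) : EReal) := by
  unfold hd
  split_ifs
  · exact_mod_cast sub_nonneg.2 hml
  · exact sInf_le ⟨l, m, rfl, fun i => EReal.coe_le_coe_iff.2 (hm i),
      fun i => EReal.coe_le_coe_iff.2 (hl i)⟩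

/-- A vector at finite Hilbert distance from a real vector is real. -/
lemma exists_eq_ofReal_of_hd_le {n : ℕ} {b : Fin n → ℝ} {x : Fin n → EReal} {r : ℝ}
    (hx : IsRmax x) (h : hd (ofReal b) x ≤ r) :
    ∃ y : Fin n → ℝ, x = ofReal y ∧ ∀ i j, (b i - y i) - (b j - y j) ≤ r := by
  rcases isEmpty_or_nonempty (Fin n) with hn | ⟨⟨i₀⟩⟩
  · exact ⟨0, Subsingleton.elim _ _, fun i => isEmptyElim i⟩
  have hb : ¬ (ofReal b = ⊥ ∧ x = ⊥) := fun hbot =>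
    EReal.coe_ne_bot (b i₀) (congrFun hbot.1 i₀)
  rw [hd, if_neg hb] at h
  obtain ⟨_, ⟨l, m, -, -, hl⟩, -⟩ := sInf_lt_iff.1 (h.trans_lt (EReal.coe_lt_top r))
  have hxbot (i : Fin n) : x i ≠ ⊥ := fun hi => by
    simpa [hi, ofReal] using hl i
  lift x to Fin n → ℝ using fun i => ⟨hx i, hxbot i⟩ with y
  refine ⟨y, rfl, fun i j => ?_⟩
  rw [← EReal.coe_le_coe_iff]
  refine le_trans (le_sInf ?_) h
  rintro _ ⟨l, m, rfl, hm, hl⟩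
  have hmj : m + y j ≤ b j := EReal.coe_le_coe_iff.1 (hm j)
  have hli : b i ≤ l + y i := EReal.coe_le_coe_iff.1 (hl i)
  norm_cast
  linarith

/-- For `λ ∈ [-∞,0]` and `a ∈ ℝ^n`, the Hilbert ball `B(-a,-λ)` is
contained in `Col(V)` if and only if `T(a) ≤ λ + a` entrywise, where `T = T_V`. -/
theorem stmt2 {n p : ℕ} (V : Fin n → Fin p → EReal)
    (hVtop : ∀ i k, V i k ≠ ⊤)
    (hrow : ∀ i, ∃ k, V i k ≠ ⊥) (hcol : ∀ k, ∃ i, V i k ≠ ⊥)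
    (lam : EReal) (hlam : lam ≤ 0) (a : Fin n → ℝ) :
    ball (ofReal (fun i => - a i)) (-lam) ⊆ colSpace V ↔
      ∀ i, TV V (ofReal a) i ≤ lam + (a i : EReal) := by
  constructor
  · intro hball i
    rw [TV_le_iff hVtop (hrow i)]
    induction lam with
    | top => simp at hlam
    | bot =>
      let x : Fin n → EReal := fun j => if j = i then 0 else ⊥
      have hx : IsRmax x := fun j => by by_cases hj : j = i <;> simp [x, hj]
      obtain ⟨k, hk, hle⟩ :=
        (mem_colSpace_iff hVtop hrow hx).1 (hball ⟨hx, by simp⟩) i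
      refine ⟨k, hk, fun j hj => ?_⟩
      have hjk := hle j
      simp only [x, hj, if_true, if_false, le_bot_iff, EReal.add_eq_bot_iff, zero_sub,
        EReal.neg_eq_bot_iff, hVtop i k, or_false] at hjk
      simp [hjk]
    | coe c =>
      have hc : c ≤ 0 := by exact_mod_cast hlam
      let y : Fin n → ℝ := fun j => if j = i then -a i - c else -a j
      have hx : IsRmax (ofReal y) := fun j => EReal.coe_ne_top _
      have hd_le : hd (ofReal fun i => -a i) (ofReal y) ≤ -(c : EReal) := by
        have := hd_ofReal_ofReal_le (b := fun i => -a i) (y := y) (l := 0) (m := c)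
          (fun j => by by_cases hj : j = i <;> simp [y, hj, hc])
          (fun j => by by_cases hj : j = i <;> simp [y, hj, hc]) hc
        simpa using this
      obtain ⟨k, hk, hle⟩ := (mem_colSpace_iff hVtop hrow hx).1 (hball ⟨hx, hd_le⟩) i
      refine ⟨k, hk, fun j hj => ?_⟩
      have hjk := hle j
      simp only [ofReal, y, hj, if_true, if_false] at hjk ⊢
      lift V i k to ℝ using ⟨hVtop i k, hk⟩ with v
      induction hw : V j k with
      | bot => simp
      | top => exact absurd hw (hVtop j k)
      | coe w =>
        rw [hw] at hjk
        norm_cast at hjk ⊢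
        linarith
  · rintro hT x ⟨hx, hd_le⟩
    rw [mem_colSpace_iff hVtop hrow hx]
    intro i
    obtain ⟨k, hk, hle⟩ := (TV_le_iff hVtop (hrow i)).1 (hT i)
    refine ⟨k, hk, fun j => ?_⟩
    rcases eq_or_ne j i with rfl | hj
    · lift V j k to ℝ using ⟨hVtop j k, hk⟩ with v
      induction x j with
      | bot => simp
      | top => exact le_top
      | coe r => norm_cast; linarith
    have hjk := hle j hj
    induction hw : V j k with
    | bot => simp
    | top => exact absurd hw (hVtop j k)
    | coe w =>
      rw [hw] at hjk
      simp only [ofReal] at hjk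
      induction lam with
      | top => simp at hlam
      | bot =>
        rw [EReal.bot_add, EReal.bot_add, le_bot_iff] at hjk
        exact absurd hjk (EReal.coe_ne_bot (w + a j))
      | coe c =>
        obtain ⟨y, rfl, hy⟩ := exists_eq_ofReal_of_hd_le (r := -c) hx (by simpa using hd_le)
        have hyji := hy j i
        simp only [ofReal]
        lift V i k to ℝ using ⟨hVtop i k, hk⟩ with v
        norm_cast at hjk ⊢
        linarith

end TropReg
end
end

section
/- The following assertions are equivalent: (1) inradius(Col(V)) = +∞; (2) there is no nonempty I ⊆ [n] such that the part P_I satisfies T(P_I) ⊆ P_I; (3) T^n(0) = ⊥, where T^n is the n-fold iterate of T and 0 is the zero vector of R^n; (4) ρ(T) = −∞. -/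
open scoped Classical BigOperators

noncomputable section

namespace TropReg

/-- The part `P_I` of `(Rmax)^n`: vectors with support exactly `I`. -/
def part {n : ℕ} (I : Set (Fin n)) : Set (Fin n → EReal) :=
  { x | IsRmax x ∧ { i | x i ≠ ⊥ } = I }

section Shapley

variable {n p : ℕ} {V : Fin n → Fin p → EReal}

theorem iSup₂_ne_top_of_finite {ι : Type*} [Finite ι] {S : Set ι} {f : ι → EReal}
    (h : ∀ i ∈ S, f i ≠ ⊤) : (⨆ i ∈ S, f i) ≠ ⊤ := by
  rw [iSup_subtype']
  rcases isEmpty_or_nonempty S with hS | hS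
  · simp
  · obtain ⟨i, hi⟩ := exists_eq_ciSup_of_finite (f := fun i : S => f i)
    rw [← hi]
    exact h i i.2

theorem iInf₂_ne_bot_of_finite {ι : Type*} [Finite ι] {S : Set ι} {f : ι → EReal}
    (h : ∀ i ∈ S, f i ≠ ⊥) : (⨅ i ∈ S, f i) ≠ ⊥ := by
  rw [iInf_subtype']
  rcases isEmpty_or_nonempty S with hS | hS
  · rw [iInf_of_empty]
    exact top_ne_bot
  · obtain ⟨i, hi⟩ := exists_eq_ciInf_of_finite (f := fun i : S => f i)
    rw [← hi]
    exact h i i.2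

theorem neg_coe_add_coe_add (c : ℝ) (x : EReal) : -(c : EReal) + (c + x) = x := by
  rw [← add_assoc, ← EReal.coe_neg, ← EReal.coe_add, neg_add_cancel, EReal.coe_zero, zero_add]

theorem coe_add_neg_coe_add (c : ℝ) (x : EReal) : (c : EReal) + (-c + x) = x := by
  rw [← add_assoc, ← EReal.coe_neg, ← EReal.coe_add, add_neg_cancel, EReal.coe_zero, zero_add]

/-- The action of the Shapley operator of `V` on supports. -/
def supportMap (V : Fin n → Fin p → EReal) (I : Set (Fin n)) : Set (Fin n) :=
  { i | ∀ k, V i k ≠ ⊥ → ∃ j, j ≠ i ∧ V j k ≠ ⊥ ∧ j ∈ I }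

theorem supportMap_mono (V : Fin n → Fin p → EReal) : Monotone (supportMap V) := by
  intro I J hIJ i hi k hk
  obtain ⟨j, hj, hjk, hjI⟩ := hi k hk
  exact ⟨j, hj, hjk, hIJ hjI⟩

theorem TV_mono (V : Fin n → Fin p → EReal) : Monotone (TV V) := by
  intro x y hxy i
  exact iInf₂_mono fun k _ => add_le_add le_rfl
    (iSup₂_mono fun j _ => add_le_add le_rfl (hxy j))

theorem TV_coe_add_le (V : Fin n → Fin p → EReal) (c : ℝ) (x : Fin n → EReal) (i : Fin n) :
    TV V (fun j => (c : EReal) + x j) i ≤ c + TV V x i := by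
  have h : -(c : EReal) + TV V (fun j => (c : EReal) + x j) i ≤ TV V x i := by
    refine le_iInf₂ fun k hk => ?_
    have h1 : TV V (fun j => (c : EReal) + x j) i ≤
        c + (-(V i k) + ⨆ j ∈ { j : Fin n | j ≠ i }, (V j k + x j)) := by
      refine (iInf₂_le k hk).trans ?_
      rw [add_left_comm]
      refine add_le_add le_rfl (iSup₂_le fun j hj => ?_)
      rw [add_left_comm]
      exact add_le_add le_rfl (le_iSup₂ (f := fun j _ => V j k + x j) j hj)
    calc _ ≤ -(c : EReal) + (c + (-(V i k) + ⨆ j ∈ { j : Fin n | j ≠ i }, (V j k + x j))) :=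
          add_le_add le_rfl h1
      _ = _ := neg_coe_add_coe_add _ _
  calc _ = (c : EReal) + (-c + TV V (fun j => (c : EReal) + x j) i) :=
        (coe_add_neg_coe_add _ _).symm
    _ ≤ _ := add_le_add le_rfl h

theorem TV_coe_add (V : Fin n → Fin p → EReal) (c : ℝ) (x : Fin n → EReal) :
    TV V (fun j => (c : EReal) + x j) = fun i => (c : EReal) + TV V x i := by
  funext i
  refine le_antisymm (TV_coe_add_le V c x i) ?_
  have h := TV_coe_add_le V (-c) (fun j => (c : EReal) + x j) i
  simp only [EReal.coe_neg, neg_coe_add_coe_add] at h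
  calc (c : EReal) + TV V x i ≤ c + (-c + TV V (fun j => (c : EReal) + x j) i) :=
        add_le_add le_rfl h
    _ = _ := coe_add_neg_coe_add _ _

theorem isRmax_TV (hVtop : ∀ i k, V i k ≠ ⊤) (hrow : ∀ i, ∃ k, V i k ≠ ⊥)
    {x : Fin n → EReal} (hx : IsRmax x) : IsRmax (TV V x) := by
  intro i
  obtain ⟨k, hk⟩ := hrow i
  refine ne_top_of_le_ne_top ?_ (iInf₂_le k hk)
  refine EReal.add_ne_top (by simpa [EReal.neg_eq_top_iff] using hk) ?_
  exact iSup₂_ne_top_of_finite fun j _ => EReal.add_ne_top (hVtop j k) (hx j)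

theorem support_TV (hVtop : ∀ i k, V i k ≠ ⊤) (x : Fin n → EReal) :
    { i | TV V x i ≠ ⊥ } = supportMap V { i | x i ≠ ⊥ } := by
  ext i
  constructor
  · intro hi k hk
    have h : -(V i k) + ⨆ j ∈ { j : Fin n | j ≠ i }, (V j k + x j) ≠ ⊥ :=
      ne_bot_of_le_ne_bot hi (iInf₂_le k hk)
    by_contra! hcon
    apply h
    rw [EReal.add_eq_bot_iff]
    right
    simp only [iSup_eq_bot]
    intro j hj
    rw [EReal.add_eq_bot_iff]
    by_cases hjk : V j k = ⊥
    · exact Or.inl hjk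
    · exact Or.inr (by simpa using hcon j hj hjk)
  · intro hi
    refine iInf₂_ne_bot_of_finite fun k hk => ?_
    obtain ⟨j, hj, hjk, hjx⟩ := hi k hk
    rw [Ne, EReal.add_eq_bot_iff, not_or]
    refine ⟨by simpa [EReal.neg_eq_bot_iff] using hVtop i k, ?_⟩
    refine ne_bot_of_le_ne_bot ?_ (le_iSup₂ (f := fun j _ => V j k + x j) j hj)
    rw [Ne, EReal.add_eq_bot_iff, not_or]
    exact ⟨hjk, hjx⟩

theorem continuousAt_TV (hVtop : ∀ i k, V i k ≠ ⊤) {u : Fin n → EReal} (hu : IsRmax u) :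
    ContinuousAt (TV V) u := by
  refine continuousAt_pi.2 fun i => ?_
  have hadd : ∀ j k, ContinuousAt (fun x : Fin n → EReal => V j k + x j) u := fun j k =>
    ContinuousAt.comp (f := fun x : Fin n → EReal => (V j k, x j))
      (EReal.continuousAt_add (Or.inl (hVtop j k)) (Or.inr (hu j)))
      (continuousAt_const.prodMk (continuous_apply j).continuousAt)
  have hsup : ∀ k, ContinuousAt
      (fun x : Fin n → EReal => ⨆ j ∈ { j : Fin n | j ≠ i }, (V j k + x j)) u := by
    intro k
    have h := ContinuousAt.finset_sup_apply (s := Finset.univ.filter fun j : Fin n => j ≠ i)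
      (f := fun j (x : Fin n → EReal) => V j k + x j) (x := u) fun j _ => hadd j k
    simpa [Finset.sup_eq_iSup] using h
  have h := ContinuousAt.finset_inf_apply
    (s := Finset.univ.filter fun k : Fin p => V i k ≠ ⊥)
    (f := fun k (x : Fin n → EReal) =>
      -(V i k) + ⨆ j ∈ { j : Fin n | j ≠ i }, (V j k + x j)) (x := u) ?_
  · simpa [Finset.inf_eq_iInf, TV] using h
  · intro k hk
    have hk : V i k ≠ ⊥ := by simpa using hk
    exact ContinuousAt.comp
      (f := fun x : Fin n → EReal => (-(V i k), ⨆ j ∈ { j : Fin n | j ≠ i }, (V j k + x j)))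
      (EReal.continuousAt_add (Or.inl (by simpa [EReal.neg_eq_top_iff] using hk))
        (Or.inl (by simpa [EReal.neg_eq_bot_iff] using hVtop i k)))
      (continuousAt_const.prodMk (hsup k))

/-- The vector with entries `x i` on `I` and `-∞` elsewhere. -/
def extendBot (I : Set (Fin n)) (x : Fin n → ℝ) : Fin n → EReal :=
  fun i => if i ∈ I then (x i : EReal) else ⊥

theorem extendBot_mem_part (I : Set (Fin n)) (x : Fin n → ℝ) : extendBot I x ∈ part I := by
  refine ⟨fun i => ?_, ?_⟩
  · unfold extendBot
    split_ifs <;> simp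
  · ext i
    by_cases hi : i ∈ I <;> simp [extendBot, hi]

theorem TV_mem_part_iff (hVtop : ∀ i k, V i k ≠ ⊤) (hrow : ∀ i, ∃ k, V i k ≠ ⊥)
    {I : Set (Fin n)} {x : Fin n → EReal} (hx : x ∈ part I) :
    TV V x ∈ part I ↔ supportMap V I = I := by
  have h := support_TV hVtop x
  rw [hx.2] at h
  exact ⟨fun hT => h ▸ hT.2, fun hI => ⟨isRmax_TV hVtop hrow hx.1, h.trans hI⟩⟩

theorem exists_invariant_part_iff (hVtop : ∀ i k, V i k ≠ ⊤) (hrow : ∀ i, ∃ k, V i k ≠ ⊥) :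
    (∃ I : Set (Fin n), I.Nonempty ∧ ∀ x ∈ part I, TV V x ∈ part I) ↔
      ∃ I : Set (Fin n), I.Nonempty ∧ supportMap V I = I := by
  refine exists_congr fun I => and_congr_right fun _ => ⟨fun h => ?_, fun h x hx => ?_⟩
  · have h0 := extendBot_mem_part I 0
    exact (TV_mem_part_iff hVtop hrow h0).1 (h _ h0)
  · exact (TV_mem_part_iff hVtop hrow hx).2 h

theorem support_iterate_TV (hVtop : ∀ i k, V i k ≠ ⊤) (m : ℕ) :
    { i | (TV V)^[m] (fun _ => (0 : EReal)) i ≠ ⊥ } = (supportMap V)^[m] Set.univ := by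
  induction m with
  | zero => simp
  | succ m ih =>
    rw [Function.iterate_succ_apply', Function.iterate_succ_apply', support_TV hVtop, ih]

theorem iterate_TV_eq_bot_iff (hVtop : ∀ i k, V i k ≠ ⊤) (m : ℕ) :
    (TV V)^[m] (fun _ => (0 : EReal)) = ⊥ ↔ (supportMap V)^[m] Set.univ = ∅ := by
  rw [← support_iterate_TV hVtop, Set.eq_empty_iff_forall_notMem]
  simp [funext_iff]

theorem iterate_supportMap_eq_empty_iff (V : Fin n → Fin p → EReal) :
    (supportMap V)^[n] Set.univ = ∅ ↔
      ¬ ∃ I : Set (Fin n), I.Nonempty ∧ supportMap V I = I := by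
  constructor
  · rintro h ⟨I, hne, hI⟩
    have hsub : I ⊆ (supportMap V)^[n] Set.univ := by
      have := (supportMap_mono V).iterate n (Set.subset_univ I)
      rwa [Function.iterate_fixed hI] at this
    rw [h] at hsub
    exact hne.ne_empty (Set.subset_empty_iff.1 hsub)
  · intro h
    have hanti : ∀ m, (supportMap V)^[m + 1] Set.univ ⊆ (supportMap V)^[m] Set.univ := by
      intro m
      rw [Function.iterate_succ_apply]
      exact (supportMap_mono V).iterate m (Set.subset_univ _)
    have key : ∀ m, (supportMap V)^[m] Set.univ = ∅ ∨
        ((supportMap V)^[m] Set.univ).ncard + m ≤ n := by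
      intro m
      induction m with
      | zero => right; simp [Set.ncard_univ]
      | succ m ih =>
        have hsub := hanti m
        rcases ih with ih | ih
        · left
          rw [ih] at hsub
          exact Set.subset_empty_iff.1 hsub
        · by_cases he : ((supportMap V)^[m] Set.univ).Nonempty
          · right
            have hlt := Set.ncard_lt_ncard (hsub.ssubset_of_ne fun heq => h ⟨_, he, by
              rwa [Function.iterate_succ_apply'] at heq⟩)
            omega
          · left
            rw [Set.not_nonempty_iff_eq_empty.1 he] at hsub
            exact Set.subset_empty_iff.1 hsub
    rcases key n with h0 | h0
    · exact h0
    · exact (Set.ncard_eq_zero (Set.toFinite _)).1 (by omega)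

theorem extendBot_le_coe_add (I : Set (Fin n)) (x y : Fin n → ℝ) :
    extendBot I x ≤ fun i => ((dist x y : ℝ) : EReal) + extendBot I y i := by
  intro i
  by_cases hi : i ∈ I
  · simp only [extendBot, hi, if_true]
    rw [← EReal.coe_add, EReal.coe_le_coe_iff]
    have := (le_abs_self _).trans ((Real.dist_eq (x i) (y i)).symm.le.trans (dist_le_pi_dist x y i))
    linarith
  · simp [extendBot, hi]

/-- The restriction of the Shapley operator of `V` to a part `P_I`, in real coordinates. -/
def realTV (V : Fin n → Fin p → EReal) (I : Set (Fin n)) (x : Fin n → ℝ) : Fin n → ℝ :=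
  fun i => if i ∈ I then (TV V (extendBot I x) i).toReal else 0

theorem extendBot_realTV (hVtop : ∀ i k, V i k ≠ ⊤) (hrow : ∀ i, ∃ k, V i k ≠ ⊥)
    {I : Set (Fin n)} (hI : supportMap V I = I) (x : Fin n → ℝ) :
    extendBot I (realTV V I x) = TV V (extendBot I x) := by
  have h := (TV_mem_part_iff hVtop hrow (extendBot_mem_part I x)).2 hI
  funext i
  by_cases hi : i ∈ I
  · have hb : TV V (extendBot I x) i ≠ ⊥ := by
      have := h.2.symm ▸ hi
      exact this
    simp only [extendBot, realTV, hi, if_true]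
    exact EReal.coe_toReal (h.1 i) hb
  · have hb : TV V (extendBot I x) i = ⊥ := by
      by_contra hne
      exact hi (h.2 ▸ hne)
    rw [hb]
    simp [extendBot, hi]

theorem dist_realTV_le (hVtop : ∀ i k, V i k ≠ ⊤) (hrow : ∀ i, ∃ k, V i k ≠ ⊥)
    {I : Set (Fin n)} (hI : supportMap V I = I) (x y : Fin n → ℝ) :
    dist (realTV V I x) (realTV V I y) ≤ dist x y := by
  have key : ∀ x y : Fin n → ℝ, ∀ i ∈ I, realTV V I x i ≤ dist x y + realTV V I y i := by
    intro x y i hi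
    have h := (TV_mono V (extendBot_le_coe_add I x y) i).trans (TV_coe_add_le V _ _ i)
    rw [← extendBot_realTV hVtop hrow hI, ← extendBot_realTV hVtop hrow hI] at h
    simp only [extendBot, hi, if_true] at h
    rwa [← EReal.coe_add, EReal.coe_le_coe_iff] at h
  refine (dist_pi_le_iff dist_nonneg).2 fun i => ?_
  by_cases hi : i ∈ I
  · have h1 := key x y i hi
    have h2 := key y x i hi
    rw [dist_comm y x] at h2
    rw [Real.dist_eq, abs_le]
    constructor <;> linarith
  · simp [realTV, hi]

/-- Discounted eigenvectors, with a bound on the eigenvalue uniform in the discount factor. -/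
theorem exists_discounted_eigenvector (hVtop : ∀ i k, V i k ≠ ⊤) (hrow : ∀ i, ∃ k, V i k ≠ ⊥)
    {I : Set (Fin n)} (hne : I.Nonempty) (hI : supportMap V I = I) {α : NNReal}
    (h0 : 0 < α) (h1 : α < 1) :
    ∃ c ∈ Set.Icc (-‖realTV V I 0‖) ‖realTV V I 0‖, ∃ v : Fin n → EReal,
      (∀ i, v i ≤ 0) ∧ (∃ i, v i = 0) ∧
      TV V (fun i => ((α : ℝ) : EReal) * v i) = fun i => (c : EReal) + v i := by
  have hc : ContractingWith α fun x : Fin n → ℝ => realTV V I ((α : ℝ) • x) := by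
    refine ⟨h1, LipschitzWith.of_dist_le_mul fun x y => ?_⟩
    refine (dist_realTV_le hVtop hrow hI _ _).trans ?_
    rw [dist_smul₀]
    simp
  obtain ⟨x, hx⟩ : ∃ x : Fin n → ℝ, x = ContractingWith.fixedPoint _ hc := ⟨_, rfl⟩
  have hfix : realTV V I ((α : ℝ) • x) = x := hx ▸ hc.fixedPoint_isFixedPt
  have hα1 : (0 : ℝ) < 1 - α := sub_pos.2 (by exact_mod_cast h1)
  have hbound : (1 - (α : ℝ)) * ‖x‖ ≤ ‖realTV V I 0‖ := by
    have h := hc.dist_fixedPoint_le 0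
    rw [← hx, le_div_iff₀ hα1] at h
    simpa [mul_comm] using h
  obtain ⟨m, hm, hmax⟩ := Set.exists_max_image I x (Set.toFinite I) hne
  refine ⟨(1 - (α : ℝ)) * x m, ?_, extendBot I fun i => x i - x m, ?_, ⟨m, ?_⟩, ?_⟩
  · refine Set.mem_Icc.2 (abs_le.1 ?_)
    rw [abs_mul, abs_of_pos hα1]
    exact (mul_le_mul_of_nonneg_left (norm_le_pi_norm x m) hα1.le).trans hbound
  · intro i
    by_cases hi : i ∈ I
    · simp only [extendBot, hi, if_true]
      exact_mod_cast sub_nonpos.2 (hmax i hi)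
    · simp [extendBot, hi]
  · simp [extendBot, hm]
  · have hT := extendBot_realTV hVtop hrow hI ((α : ℝ) • x)
    rw [hfix] at hT
    have hs : (fun i => ((α : ℝ) : EReal) * extendBot I (fun i => x i - x m) i) =
        fun i => ((-(α * x m) : ℝ) : EReal) + extendBot I ((α : ℝ) • x) i := by
      funext i
      by_cases hi : i ∈ I
      · simp only [extendBot, hi, if_true]
        rw [← EReal.coe_mul, ← EReal.coe_add, EReal.coe_eq_coe_iff]
        simp only [Pi.smul_apply, smul_eq_mul]
        ring
      · simp only [extendBot, hi, if_false, EReal.add_bot]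
        exact EReal.coe_mul_bot_of_pos (by exact_mod_cast h0)
    rw [hs, TV_coe_add, ← hT]
    funext i
    by_cases hi : i ∈ I
    · simp only [extendBot, hi, if_true]
      rw [← EReal.coe_add, ← EReal.coe_add, EReal.coe_eq_coe_iff]
      ring
    · simp [extendBot, hi]

/-- A part invariant under the Shapley operator yields an eigenvector with a finite eigenvalue:
let the discount factor tend to `1`. -/
theorem exists_eigenvector (hVtop : ∀ i k, V i k ≠ ⊤) (hrow : ∀ i, ∃ k, V i k ≠ ⊥)
    {I : Set (Fin n)} (hne : I.Nonempty) (hI : supportMap V I = I) :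
    ∃ c : ℝ, ∃ u : Fin n → EReal, IsRmax u ∧ u ≠ ⊥ ∧ TV V u = fun i => (c : EReal) + u i := by
  obtain ⟨α, -, hαmem, hα⟩ := exists_seq_strictMono_tendsto' (zero_lt_one (α := NNReal))
  choose c hc v hv hv0 hT using fun m =>
    exists_discounted_eigenvector hVtop hrow hne hI (hαmem m).1 (hαmem m).2
  obtain ⟨l, hl⟩ : ∃ l : Ultrafilter ℕ, (l : Filter ℕ) ≤ Filter.atTop :=
    ⟨Ultrafilter.of Filter.atTop, Ultrafilter.of_le _⟩
  obtain ⟨lam, -, hlam⟩ := isCompact_iff_ultrafilter_le_nhds.1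
    (isCompact_Icc (a := -‖realTV V I 0‖) (b := ‖realTV V I 0‖)) (l.map c)
    (Filter.le_principal_iff.2 (Filter.Eventually.of_forall (f := (l : Filter ℕ)) hc))
  have hclosed : IsClosed { v : Fin n → EReal | (∀ i, v i ≤ 0) ∧ ∃ i, v i = 0 } := by
    have hset : { v : Fin n → EReal | (∀ i, v i ≤ 0) ∧ ∃ i, v i = 0 } =
        (⋂ i, { v | v i ≤ 0 }) ∩ ⋃ i, { v | v i = 0 } := by
      ext v
      simp
    rw [hset]
    exact (isClosed_iInter fun i => isClosed_le (continuous_apply i) continuous_const).inter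
      (isClosed_iUnion_of_finite fun i => isClosed_eq (continuous_apply i) continuous_const)
  obtain ⟨u, hu, hlim⟩ := isCompact_iff_ultrafilter_le_nhds.1 hclosed.isCompact (l.map v)
    (Filter.le_principal_iff.2
      (Filter.Eventually.of_forall (f := (l : Filter ℕ)) fun m => ⟨hv m, hv0 m⟩))
  have hlam : Filter.Tendsto c l (nhds lam) := hlam
  have hlim : Filter.Tendsto v l (nhds u) := hlim
  have hutop : IsRmax u := fun i => ne_top_of_le_ne_top EReal.zero_ne_top (hu.1 i)
  refine ⟨lam, u, hutop, ?_, ?_⟩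
  · rintro rfl
    obtain ⟨i, hi⟩ := hu.2
    simp at hi
  have hαl : Filter.Tendsto (fun m => ((α m : ℝ) : EReal)) l (nhds ((1 : ℝ) : EReal)) :=
    (continuous_coe_real_ereal.tendsto _).comp
      ((NNReal.continuous_coe.tendsto _).comp (hα.mono_left hl))
  have hmul : Filter.Tendsto (fun m i => ((α m : ℝ) : EReal) * v m i) l (nhds u) := by
    refine tendsto_pi_nhds.2 fun i => ?_
    have h := (EReal.continuousAt_mul (p := (((1 : ℝ) : EReal), u i)) (by simp) (by simp)
      (Or.inl (EReal.coe_ne_bot _)) (Or.inl (EReal.coe_ne_top _))).tendsto.comp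
        (hαl.prodMk_nhds (tendsto_pi_nhds.1 hlim i))
    simpa [Function.comp_def] using h
  have h1 := (continuousAt_TV hVtop hutop).tendsto.comp hmul
  have h2 : Filter.Tendsto (fun m i => (c m : EReal) + v m i) l
      (nhds fun i => (lam : EReal) + u i) := by
    refine tendsto_pi_nhds.2 fun i => ?_
    exact (EReal.continuousAt_add (p := ((lam : EReal), u i)) (by simp) (by simp)).tendsto.comp
        (((continuous_coe_real_ereal.tendsto _).comp hlam).prodMk_nhds
          (tendsto_pi_nhds.1 hlim i))
  refine tendsto_nhds_unique h1 (h2.congr fun m => ?_)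
  exact (hT m).symm

theorem rho_eq_bot_iff (hVtop : ∀ i k, V i k ≠ ⊤) (hrow : ∀ i, ∃ k, V i k ≠ ⊥) :
    rho (TV V) = ⊥ ↔ ¬ ∃ I : Set (Fin n), I.Nonempty ∧ supportMap V I = I := by
  constructor
  · rintro h ⟨I, hne, hI⟩
    obtain ⟨c, u, hu, hu0, hT⟩ := exists_eigenvector hVtop hrow hne hI
    have := (sSup_eq_bot.1 h) c ⟨EReal.coe_ne_top c, u, hu, hu0, hT⟩
    exact EReal.coe_ne_bot c this
  · intro h
    refine sSup_eq_bot.2 ?_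
    rintro lam ⟨-, u, -, hu0, hT⟩
    by_contra hlam
    refine h ⟨{ i | u i ≠ ⊥ }, ?_, ?_⟩
    · by_contra hemp
      refine hu0 (funext fun i => ?_)
      by_contra hi
      exact hemp ⟨i, hi⟩
    · rw [← support_TV hVtop, hT]
      ext i
      simp [EReal.add_eq_bot_iff, hlam]

theorem exists_entry_gap_bound (V : Fin n → Fin p → EReal) :
    ∃ M : ℝ, ∀ i j k, (V i k).toReal - (V j k).toReal ≤ M := by
  obtain ⟨M, hM⟩ := (Set.finite_range fun q : Fin n × Fin n × Fin p =>
    (V q.1 q.2.2).toReal - (V q.2.1 q.2.2).toReal).bddAbove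
  exact ⟨M, fun i j k => hM ⟨(i, j, k), rfl⟩⟩

theorem hd_ofReal_le_bounds {a : Fin n → ℝ} {x : Fin n → EReal} {s : ℝ}
    (hs : 0 ≤ s) (h : hd (ofReal a) x ≤ s) :
    ∃ lam mu : ℝ, lam - mu < s + 1 ∧ (∀ i, (mu : EReal) + x i ≤ a i) ∧
      ∀ i, (a i : EReal) ≤ lam + x i := by
  unfold hd at h
  split_ifs at h with hbot
  · refine ⟨0, 0, by linarith, fun i => ?_, fun i => ?_⟩ <;>
      exact absurd (congrFun hbot.1 i) (EReal.coe_ne_bot (a i))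
  · have hlt := h.trans_lt (EReal.coe_lt_coe_iff.2 (lt_add_one s))
    obtain ⟨t, ⟨lam, mu, rfl, h1, h2⟩, ht⟩ := sInf_lt_iff.1 hlt
    refine ⟨lam, mu, ?_, h1, h2⟩
    exact_mod_cast ht

theorem inradius_ne_top_of_fixed (hVtop : ∀ i k, V i k ≠ ⊤) {I : Set (Fin n)}
    (hne : I.Nonempty) (hI : supportMap V I = I) : inradius (colSpace V) ≠ ⊤ := by
  obtain ⟨M, hM⟩ := exists_entry_gap_bound V
  refine ne_top_of_le_ne_top (EReal.coe_ne_top M) (sSup_le ?_)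
  rintro _ ⟨s, rfl, hs, a, hball⟩
  obtain ⟨m, hm, hmax⟩ := Set.exists_max_image I a (Set.toFinite I) hne
  have hmem : ofReal (fun i => if i = m then a i + s else a i) ∈ ball (ofReal a) (s : EReal) := by
    refine ⟨fun i => EReal.coe_ne_top _, ?_⟩
    unfold hd
    rw [if_neg fun h => EReal.coe_ne_bot (a m) (congrFun h.1 m)]
    refine sInf_le ⟨0, -s, ?_, fun i => ?_, fun i => ?_⟩
    · rw [← EReal.coe_sub]; simp
    · simp only [ofReal]
      rw [← EReal.coe_add, EReal.coe_le_coe_iff]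
      split_ifs <;> linarith
    · simp only [ofReal]
      rw [← EReal.coe_add, EReal.coe_le_coe_iff]
      split_ifs <;> linarith
  obtain ⟨z, hz, hy⟩ := hball hmem
  have hp : Nonempty (Fin p) := by
    by_contra hp
    rw [not_nonempty_iff] at hp
    have := congrFun hy m
    simp [ofReal] at this
  obtain ⟨k, hk⟩ := exists_eq_ciSup_of_finite (f := fun k => V m k + z k)
  have hmk : ((a m + s : ℝ) : EReal) = V m k + z k := by
    have := congrFun hy m
    simp only [ofReal, if_true] at this
    rw [this, hk]
  have hVz : V m k ≠ ⊥ ∧ z k ≠ ⊥ := by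
    rw [← not_or, ← EReal.add_eq_bot_iff, ← hmk]
    exact EReal.coe_ne_bot _
  obtain ⟨j, hjm, hjk, hjI⟩ := (hI.symm ▸ hm : m ∈ supportMap V I) k hVz.1
  have hj : V j k + z k ≤ (a j : EReal) := by
    have := congrFun hy j
    simp only [ofReal, if_neg hjm] at this
    rw [this]
    exact le_iSup (fun k => V j k + z k) k
  have h1 := hM m j k
  have h2 := hmax j hjI
  rw [← EReal.coe_toReal (hVtop m k) hVz.1, ← EReal.coe_toReal (hz k) hVz.2, ← EReal.coe_add,
    EReal.coe_eq_coe_iff] at hmk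
  rw [← EReal.coe_toReal (hVtop j k) hjk, ← EReal.coe_toReal (hz k) hVz.2, ← EReal.coe_add,
    EReal.coe_le_coe_iff] at hj
  rw [EReal.coe_le_coe_iff]
  linarith

/-- Elimination order: every `i` has a column in which all other finite entries have smaller
rank. -/
theorem exists_rank {m : ℕ} (h : (supportMap V)^[m] Set.univ = ∅) :
    ∃ f : Fin n → ℕ, ∀ i, ∃ k, V i k ≠ ⊥ ∧ ∀ j, j ≠ i → V j k ≠ ⊥ → f j < f i := by
  have hex : ∀ i, ∃ l, i ∉ (supportMap V)^[l] Set.univ := fun i => ⟨m, by simp [h]⟩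
  refine ⟨fun i => Nat.find (hex i), fun i => ?_⟩
  have hspec := Nat.find_spec (hex i)
  obtain ⟨l, hl⟩ : ∃ l, Nat.find (hex i) = l + 1 := by
    refine Nat.exists_eq_succ_of_ne_zero fun h0 => ?_
    rw [h0] at hspec
    exact hspec (Set.mem_univ i)
  rw [hl, Function.iterate_succ_apply'] at hspec
  simp only [supportMap, Set.mem_ofPred_eq, not_forall, not_exists, not_and] at hspec
  obtain ⟨k, hk, hjk⟩ := hspec
  refine ⟨k, hk, fun j hji hj => ?_⟩
  change Nat.find (hex j) < Nat.find (hex i)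
  rw [hl, Nat.lt_succ_iff]
  exact Nat.find_min' (hex j) (hjk j hji hj)

theorem mem_colSpace_of_residual (hVtop : ∀ i k, V i k ≠ ⊤) (hcol : ∀ k, ∃ i, V i k ≠ ⊥)
    (x : Fin n → ℝ)
    (h : ∀ i, ∃ k, V i k ≠ ⊥ ∧
      ∀ j, V j k ≠ ⊥ → x i - (V i k).toReal ≤ x j - (V j k).toReal) :
    ofReal x ∈ colSpace V := by
  refine ⟨fun k => ⨅ j ∈ { j : Fin n | V j k ≠ ⊥ }, ((x j - (V j k).toReal : ℝ) : EReal),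
    fun k => ?_, ?_⟩
  · obtain ⟨i, hi⟩ := hcol k
    exact ne_top_of_le_ne_top (EReal.coe_ne_top _) (iInf₂_le i hi)
  · funext i
    refine le_antisymm ?_ (iSup_le fun k => ?_)
    · obtain ⟨k, hk, hj⟩ := h i
      refine le_trans ?_ (le_iSup _ k)
      calc ofReal x i = ((V i k).toReal : EReal) + ((x i - (V i k).toReal : ℝ) : EReal) := by
            rw [← EReal.coe_add]; simp [ofReal]
        _ ≤ ((V i k).toReal : EReal) + _ :=
            add_le_add le_rfl (le_iInf₂ fun j hjk => EReal.coe_le_coe_iff.2 (hj j hjk))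
        _ = _ := congrArg (· + _) (EReal.coe_toReal (hVtop i k) hk)
    · by_cases hk : V i k = ⊥
      · simp [hk]
      · calc _ ≤ V i k + ((x i - (V i k).toReal : ℝ) : EReal) :=
              add_le_add le_rfl (iInf₂_le i hk)
          _ = ((V i k).toReal : EReal) + ((x i - (V i k).toReal : ℝ) : EReal) := by
              rw [EReal.coe_toReal (hVtop i k) hk]
          _ = _ := by rw [← EReal.coe_add]; simp [ofReal]

theorem inradius_eq_top_of_rank (hVtop : ∀ i k, V i k ≠ ⊤) (hcol : ∀ k, ∃ i, V i k ≠ ⊥)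
    {f : Fin n → ℕ}
    (hf : ∀ i, ∃ k, V i k ≠ ⊥ ∧ ∀ j, j ≠ i → V j k ≠ ⊥ → f j < f i) :
    inradius (colSpace V) = ⊤ := by
  obtain ⟨M, hM⟩ := exists_entry_gap_bound V
  have hball : ∀ s : ℝ, 0 ≤ s →
      ball (ofReal fun i => -(|M| + s + 1) * (f i : ℝ)) (s : EReal) ⊆ colSpace V := by
    rintro s hs x ⟨hx, hd⟩
    obtain ⟨lam, mu, hlm, h1, h2⟩ := hd_ofReal_le_bounds hs hd
    have hxbot : ∀ i, x i ≠ ⊥ := by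
      intro i hi
      have := h2 i
      rw [hi, EReal.add_bot, le_bot_iff] at this
      exact EReal.coe_ne_bot _ this
    obtain ⟨y, rfl⟩ : ∃ y : Fin n → ℝ, x = ofReal y :=
      ⟨fun i => (x i).toReal, funext fun i => (EReal.coe_toReal (hx i) (hxbot i)).symm⟩
    simp only [ofReal, ← EReal.coe_add, EReal.coe_le_coe_iff] at h1 h2
    refine mem_colSpace_of_residual hVtop hcol y fun i => ?_
    obtain ⟨k, hk, hj⟩ := hf i
    refine ⟨k, hk, fun j hjk => ?_⟩
    rcases eq_or_ne j i with rfl | hji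
    · rfl
    · have hlt : (f j : ℝ) + 1 ≤ f i := by exact_mod_cast hj j hji hjk
      have hpos : 0 ≤ |M| + s + 1 := by positivity
      have h3 := mul_le_mul_of_nonneg_left hlt hpos
      have h4 := h1 i
      have h5 := h2 j
      have h6 := hM j i k
      have h7 := le_abs_self M
      nlinarith
  rw [EReal.eq_top_iff_forall_lt]
  intro b
  refine lt_of_lt_of_le (EReal.coe_lt_coe_iff.2 ((le_abs_self b).trans_lt (lt_add_one _)))
    (le_sSup ⟨|b| + 1, rfl, by positivity, _, hball _ (by positivity)⟩)

theorem inradius_eq_top_iff (hVtop : ∀ i k, V i k ≠ ⊤) (hcol : ∀ k, ∃ i, V i k ≠ ⊥) :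
    inradius (colSpace V) = ⊤ ↔ ¬ ∃ I : Set (Fin n), I.Nonempty ∧ supportMap V I = I := by
  constructor
  · rintro h ⟨I, hne, hI⟩
    exact inradius_ne_top_of_fixed hVtop hne hI h
  · intro h
    obtain ⟨f, hf⟩ := exists_rank ((iterate_supportMap_eq_empty_iff V).2 h)
    exact inradius_eq_top_of_rank hVtop hcol hf

end Shapley

/-- The following are equivalent: (1) `inradius(Col(V)) = +∞`;
(2) no part `P_I` (with `I` nonempty) is invariant under `T`; (3) `T^n(0) = ⊥`;
(4) `ρ(T) = -∞`. -/
theorem stmt5 {n p : ℕ} (V : Fin n → Fin p → EReal)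
    (hVtop : ∀ i k, V i k ≠ ⊤)
    (hrow : ∀ i, ∃ k, V i k ≠ ⊥) (hcol : ∀ k, ∃ i, V i k ≠ ⊥) :
    (inradius (colSpace V) = ⊤ ↔
      ¬ ∃ I : Set (Fin n), I.Nonempty ∧ ∀ x ∈ part I, TV V x ∈ part I) ∧
    (inradius (colSpace V) = ⊤ ↔ (TV V)^[n] (fun _ => (0 : EReal)) = ⊥) ∧
    (inradius (colSpace V) = ⊤ ↔ rho (TV V) = ⊥) := by
  rw [inradius_eq_top_iff hVtop hcol, exists_invariant_part_iff hVtop hrow,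
    iterate_TV_eq_bot_iff hVtop, iterate_supportMap_eq_empty_iff, rho_eq_bot_iff hVtop hrow]
  exact ⟨Iff.rfl, Iff.rfl, Iff.rfl⟩

end TropReg
end
end

section
/- If a ∈ R^n, r > 0 and the Hilbert ball B(a, r) is contained in Col(V), then there exists J ⊆ [p] with |J| = n such that B(a, r) ⊆ Col(V[J]) and Col(V[J]) is a simplicial tropical cone. -/
open scoped Classical BigOperators

noncomputable section

namespace TropReg

/-- Extreme vector of a tropical cone `C`. -/
def IsExtreme {n : ℕ} (C : Set (Fin n → EReal)) (u : Fin n → EReal) : Prop :=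
  u ∈ C ∧ ∀ v ∈ C, ∀ w ∈ C, u = (fun i => v i ⊔ w i) → u = v ∨ u = w

/-- Extreme direction of a tropical cone `C`: the set of tropical scalar multiples of
an extreme vector `u ≠ ⊥`. -/
def IsExtremeDir {n : ℕ} (C : Set (Fin n → EReal)) (D : Set (Fin n → EReal)) : Prop :=
  ∃ u : Fin n → EReal, u ≠ ⊥ ∧ IsExtreme C u ∧
    D = { y | ∃ lam : EReal, lam ≠ ⊤ ∧ y = fun i => lam + u i }

/-- A tropical cone of `(Rmax)^n` is simplicial if it has exactly `n` extreme
directions. -/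
def Simplicial {n : ℕ} (C : Set (Fin n → EReal)) : Prop :=
  { D | IsExtremeDir C D }.encard = n

/-- Column space of the submatrix of `V` keeping only the columns in `J`. -/
def colSpaceJ {n p : ℕ} (V : Fin n → Fin p → EReal) (J : Finset (Fin p)) :
    Set (Fin n → EReal) :=
  { y | ∃ x : Fin p → EReal, IsRmax x ∧ y = fun i => ⨆ k ∈ J, (V i k + x k) }

lemma ofReal_mem_ball {n : ℕ} (a y : Fin n → ℝ) {r : ℝ} (hr : 0 ≤ r)
    (hl : ∀ i, a i ≤ y i) (hu : ∀ i, y i ≤ a i + r) :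
    ofReal y ∈ ball (ofReal a) (r : EReal) := by
  refine ⟨fun i => EReal.coe_ne_top _, ?_⟩
  unfold hd
  split_ifs with h
  · exact_mod_cast hr
  · refine sInf_le ⟨0, -r, ?_, fun i => ?_, fun i => ?_⟩
    · norm_cast
      simp
    · simp only [ofReal]
      norm_cast
      linarith [hu i]
    · simp only [ofReal]
      norm_cast
      linarith [hl i]

lemma exists_eq_ofReal_of_mem_ball {n : ℕ} {a : Fin n → ℝ} {r : ℝ} {x : Fin n → EReal}
    (hx : x ∈ ball (ofReal a) (r : EReal)) :
    ∃ y : Fin n → ℝ, x = ofReal y ∧ ∀ i j, (a i - y i) - (a j - y j) ≤ r := by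
  obtain ⟨htop, hd_le⟩ := hx
  have hd_eq (i : Fin n) : hd (ofReal a) x =
      sInf { t : EReal | ∃ lam mu : ℝ, t = (lam : EReal) - (mu : EReal) ∧
        (∀ i, (mu : EReal) + x i ≤ ofReal a i) ∧ (∀ i, ofReal a i ≤ (lam : EReal) + x i) } := by
    refine if_neg fun h => ?_
    exact EReal.coe_ne_bot (a i) (congrFun h.1 i)
  have hbot (i : Fin n) : x i ≠ ⊥ := by
    intro hi
    rw [hd_eq i, sInf_eq_top.2] at hd_le
    · exact EReal.coe_ne_top r (top_le_iff.1 hd_le)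
    · rintro t ⟨lam, mu, -, -, h⟩
      have := h i
      rw [hi, EReal.add_bot, le_bot_iff] at this
      exact absurd this (EReal.coe_ne_bot _)
  refine ⟨fun i => (x i).toReal, funext fun i => (EReal.coe_toReal (htop i) (hbot i)).symm,
    fun i j => ?_⟩
  rw [hd_eq i] at hd_le
  rw [← EReal.coe_le_coe_iff]
  refine le_trans (le_sInf ?_) hd_le
  rintro t ⟨lam, mu, rfl, hmu, hlam⟩
  have h1 := hlam i
  have h2 := hmu j
  rw [← EReal.coe_toReal (htop i) (hbot i)] at h1
  rw [← EReal.coe_toReal (htop j) (hbot j)] at h2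
  simp only [ofReal] at h1 h2
  norm_cast at h1 h2 ⊢
  linarith

lemma colSpaceJ_image {n m p : ℕ} (V : Fin n → Fin p → EReal) {k : Fin m → Fin p}
    (hk : Function.Injective k) :
    colSpaceJ V (Finset.univ.image k) = colSpace fun j i => V j (k i) := by
  ext y
  constructor
  · rintro ⟨x, hx, rfl⟩
    refine ⟨fun i => x (k i), fun i => hx _, funext fun j => ?_⟩
    simp only [Finset.mem_image, Finset.mem_univ, true_and, iSup_exists]
    rw [iSup_comm]
    simp
  · rintro ⟨x, hx, rfl⟩
    refine ⟨Function.extend k x ⊥, fun q => ?_, funext fun j => ?_⟩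
    · by_cases hq : ∃ i, k i = q
      · obtain ⟨i, rfl⟩ := hq
        rw [hk.extend_apply]
        exact hx i
      · rw [Function.extend_apply' _ _ _ hq]
        exact bot_ne_top
    · simp only [Finset.mem_image, Finset.mem_univ, true_and, iSup_exists]
      rw [iSup_comm]
      simp [hk.extend_apply]

lemma bot_mem_colSpace {n p : ℕ} (V : Fin n → Fin p → EReal) : ⊥ ∈ colSpace V :=
  ⟨⊥, fun _ => bot_ne_top, funext fun i => by simp⟩

lemma sup_mem_colSpace {n p : ℕ} (V : Fin n → Fin p → EReal) {y z : Fin n → EReal}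
    (hy : y ∈ colSpace V) (hz : z ∈ colSpace V) : y ⊔ z ∈ colSpace V := by
  obtain ⟨x, hx, rfl⟩ := hy
  obtain ⟨w, hw, rfl⟩ := hz
  refine ⟨x ⊔ w, fun k => ?_, funext fun i => ?_⟩
  · simpa [max_eq_iff] using fun h => (max_lt (lt_top_iff_ne_top.2 (hx k))
      (lt_top_iff_ne_top.2 (hw k))).ne h
  · simp only [Pi.sup_apply, ← iSup_sup_eq, max_add_add_left]

lemma add_col_mem_colSpace {n p : ℕ} (V : Fin n → Fin p → EReal) (k : Fin p) {c : EReal}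
    (hc : c ≠ ⊤) : (fun i => c + V i k) ∈ colSpace V := by
  refine ⟨fun q => if q = k then c else ⊥, fun q => ?_, funext fun i => ?_⟩
  · dsimp only
    split_ifs
    exacts [hc, bot_ne_top]
  · refine le_antisymm (le_iSup_of_le k (by simp [add_comm])) (iSup_le fun q => ?_)
    by_cases hq : q = k
    · simp [hq, add_comm]
    · simp [hq]

/-- An extreme vector of a column space is a multiple of a column. -/
lemma IsExtreme.exists_eq_add_col {n p : ℕ} {V : Fin n → Fin p → EReal} {u : Fin n → EReal}
    (hu : IsExtreme (colSpace V) u) (hne : u ≠ ⊥) :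
    ∃ (k : Fin p) (c : EReal), c ≠ ⊤ ∧ u = fun i => c + V i k := by
  obtain ⟨x, hx, hux⟩ := hu.1
  have key (s : Finset (Fin p)) (h : u = s.sup fun k i => x k + V i k) :
      ∃ k, u = fun i => x k + V i k := by
    induction s using Finset.induction_on with
    | empty => exact absurd h hne
    | insert k s _ ih =>
      rw [Finset.sup_insert] at h
      rcases hu.2 _ (add_col_mem_colSpace V k (hx k)) (s.sup fun k i => x k + V i k)
        (Finset.sup_induction (bot_mem_colSpace V) (fun _ hy _ hz => sup_mem_colSpace V hy hz)
          fun k _ => add_col_mem_colSpace V k (hx k)) h with h' | h'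
      · exact ⟨k, h'⟩
      · exact ih h'
  obtain ⟨k, hk⟩ := key Finset.univ (by
    rw [hux]
    ext i
    simp [Finset.sup_univ_eq_iSup, add_comm])
  exact ⟨k, x k, hx k, hk⟩

/-- The set of tropical multiples of `u`. -/
def ray {n : ℕ} (u : Fin n → EReal) : Set (Fin n → EReal) :=
  { y | ∃ lam : EReal, lam ≠ ⊤ ∧ y = fun i => lam + u i }

lemma ray_add {n : ℕ} (u : Fin n → EReal) (c : ℝ) :
    ray (fun i => (c : EReal) + u i) = ray u := by
  ext y
  constructor
  · rintro ⟨lam, hlam, rfl⟩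
    exact ⟨lam + c, (EReal.add_lt_top hlam (EReal.coe_ne_top c)).ne,
      funext fun i => (add_assoc _ _ _).symm⟩
  · rintro ⟨lam, hlam, rfl⟩
    refine ⟨lam + (-c : ℝ), (EReal.add_lt_top hlam (EReal.coe_ne_top _)).ne, funext fun i => ?_⟩
    have : ((-c : ℝ) : EReal) + c = 0 := by
      norm_cast
      simp
    rw [add_assoc, ← add_assoc ((-c : ℝ) : EReal), this, zero_add]

section Dominant

variable {n : ℕ} {M : Fin n → Fin n → EReal} {a c : Fin n → ℝ} {r : ℝ}

/-- If the multiple `x + M i` of a column of a diagonally dominant matrix attains the entry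
`c j = M j j` of another column, then it exceeds that column at the entry `i`. -/
lemma lt_add_of_dominant (hr : 0 < r) (hc : ∀ i, M i i = c i)
    (hM : ∀ i j, j ≠ i → M j i ≤ ((c i - a i + a j - r : ℝ) : EReal))
    {i j : Fin n} (hij : j ≠ i) {x : EReal} (hx : x ≠ ⊤)
    (h : (c j : EReal) ≤ M j i + x) : M i j < M i i + x := by
  have h1 := h.trans (add_le_add_left (hM i j hij) x)
  have hxb : x ≠ ⊥ := by
    rintro rfl
    simp at h1
  lift x to ℝ using ⟨hx, hxb⟩
  refine (hM j i hij.symm).trans_lt ?_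
  rw [hc]
  norm_cast at h1 ⊢
  linarith

lemma isExtreme_col_of_dominant (hr : 0 < r) (hc : ∀ i, M i i = c i)
    (hM : ∀ i j, j ≠ i → M j i ≤ ((c i - a i + a j - r : ℝ) : EReal)) (j : Fin n) :
    IsExtreme (colSpace M) (col M j) := by
  have key (v : Fin n → EReal) (hv : v ∈ colSpace M) (hle : v ≤ col M j)
      (hj : (c j : EReal) ≤ v j) : col M j = v := by
    refine le_antisymm ?_ hle
    obtain ⟨x, hx, rfl⟩ := hv
    obtain ⟨i, hi⟩ : ∃ i, (c j : EReal) ≤ M j i + x i := by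
      by_contra! hlt
      have : Nonempty (Fin n) := ⟨j⟩
      obtain ⟨i, hi⟩ := exists_eq_ciSup_of_finite (f := fun i => M j i + x i)
      exact absurd (hj.trans_eq hi.symm) (hlt i).not_ge
    obtain rfl : j = i := by
      by_contra hij
      exact absurd ((le_iSup (fun k => M i k + x k) i).trans (hle i))
        (lt_add_of_dominant hr hc hM hij (hx i) hi).not_ge
    have hx0 : 0 ≤ x j := by
      rw [hc] at hi
      by_contra! hlt
      have := EReal.add_lt_add_left_coe hlt (c j)
      rw [add_zero] at this
      exact hi.not_gt this
    intro l
    exact (le_add_of_nonneg_right hx0).trans (le_iSup (fun k => M l k + x k) j)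
  refine ⟨?_, fun v hv w hw h => ?_⟩
  · have h := add_col_mem_colSpace M j EReal.zero_ne_top
    simp only [zero_add] at h
    exact h
  · have hv' : v ≤ col M j := fun l => by rw [h]; exact le_sup_left
    have hw' : w ≤ col M j := fun l => by rw [h]; exact le_sup_right
    have hj : (c j : EReal) ≤ v j ⊔ w j := by
      rw [← hc, ← congrFun h j, col]
    rcases le_sup_iff.1 hj with hj | hj
    exacts [Or.inl (key v hv hv' hj), Or.inr (key w hw hw' hj)]

lemma ray_col_injective_of_dominant (hr : 0 < r) (hc : ∀ i, M i i = c i)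
    (hM : ∀ i j, j ≠ i → M j i ≤ ((c i - a i + a j - r : ℝ) : EReal)) :
    Function.Injective fun i => ray (col M i) := by
  intro j i hji
  by_contra hij
  have hmem : col M j ∈ ray (col M i) := by
    rw [← show ray (col M j) = ray (col M i) from hji]
    exact ⟨0, EReal.zero_ne_top, funext fun l => (zero_add _).symm⟩
  obtain ⟨lam, hlam, h⟩ := hmem
  have hcol (l : Fin n) : M l j = M l i + lam := (congrFun h l).trans (add_comm _ _)
  exact (lt_add_of_dominant hr hc hM hij hlam ((hc j).symm.trans (hcol j)).le).ne (hcol i)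

/-- The column space of a strictly diagonally dominant matrix is simplicial. -/
lemma simplicial_of_dominant (hr : 0 < r) (hc : ∀ i, M i i = c i)
    (hM : ∀ i j, j ≠ i → M j i ≤ ((c i - a i + a j - r : ℝ) : EReal)) :
    Simplicial (colSpace M) := by
  have hset : { D | IsExtremeDir (colSpace M) D } = Set.range fun i => ray (col M i) := by
    ext D
    constructor
    · rintro ⟨u, hne, hu, rfl⟩
      obtain ⟨i, b, hb, rfl⟩ := hu.exists_eq_add_col hne
      have hbot : b ≠ ⊥ := by
        rintro rfl
        exact hne (funext fun i => EReal.bot_add _)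
      lift b to ℝ using ⟨hb, hbot⟩
      exact ⟨i, (ray_add (col M i) b).symm⟩
    · rintro ⟨i, rfl⟩
      refine ⟨col M i, fun h => ?_, isExtreme_col_of_dominant hr hc hM i, rfl⟩
      exact EReal.coe_ne_bot (c i) ((hc i).symm.trans (congrFun h i))
  rw [Simplicial, hset, ← Set.image_univ,
    (ray_col_injective_of_dominant hr hc hM).encard_image, Set.encard_univ]
  simp

lemma ball_subset_colSpace_of_dominant (hc : ∀ i, M i i = c i)
    (hM : ∀ i j, j ≠ i → M j i ≤ ((c i - a i + a j - r : ℝ) : EReal)) :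
    ball (ofReal a) (r : EReal) ⊆ colSpace M := by
  intro y hy
  obtain ⟨y, rfl, hyr⟩ := exists_eq_ofReal_of_mem_ball hy
  refine ⟨ofReal fun i => y i - c i, fun i => EReal.coe_ne_top _, funext fun j => ?_⟩
  refine le_antisymm (le_iSup_of_le j ?_) (iSup_le fun i => ?_)
  · rw [hc]
    simp only [ofReal]
    norm_cast
    linarith
  · by_cases hij : j = i
    · subst hij
      rw [hc]
      simp only [ofReal]
      norm_cast
      linarith
    · refine (add_le_add_left (hM i j hij) _).trans ?_
      simp only [ofReal]
      norm_cast
      linarith [hyr j i]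

end Dominant

/-- If a ball lies in the column space of `V`, then each row `i` has a column that is dominant
at its entry `i`. -/
lemma exists_dominant_col {n p : ℕ} {V : Fin n → Fin p → EReal}
    (hVtop : ∀ i k, V i k ≠ ⊤) {a : Fin n → ℝ} {r : ℝ} (hr : 0 ≤ r)
    (hball : ball (ofReal a) (r : EReal) ⊆ colSpace V) (i : Fin n) :
    ∃ (k : Fin p) (c : ℝ), V i k = c ∧
      ∀ j, j ≠ i → V j k ≤ ((c - a i + a j - r : ℝ) : EReal) := by
  obtain ⟨x, hx, hyx⟩ := hball (ofReal_mem_ball a (fun j => if j = i then a j + r else a j) hr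
    (fun j => by split_ifs <;> linarith) (fun j => by split_ifs <;> linarith))
  have hi := congrFun hyx i
  simp only [ofReal, if_true] at hi
  have : Nonempty (Fin p) := by
    by_contra hp
    rw [not_nonempty_iff] at hp
    rw [iSup_of_empty] at hi
    exact EReal.coe_ne_bot _ hi
  obtain ⟨k, hk⟩ := exists_eq_ciSup_of_finite (f := fun k => V i k + x k)
  have hk' : ((a i + r : ℝ) : EReal) = V i k + x k := hi.trans hk.symm
  have hVb : V i k ≠ ⊥ := fun h => by simp [h, -EReal.coe_add] at hk'
  have hxb : x k ≠ ⊥ := fun h => by simp [h, -EReal.coe_add] at hk'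
  obtain ⟨c, hc⟩ : ∃ c : ℝ, V i k = c := ⟨_, (EReal.coe_toReal (hVtop i k) hVb).symm⟩
  obtain ⟨b, hb⟩ : ∃ b : ℝ, x k = b := ⟨_, (EReal.coe_toReal (hx k) hxb).symm⟩
  refine ⟨k, c, hc, fun j hj => ?_⟩
  have hjk : V j k + x k ≤ (a j : EReal) := by
    refine (le_iSup (fun k => V j k + x k) k).trans_eq ?_
    simpa [ofReal, hj] using (congrFun hyx j).symm
  rw [hc, hb] at hk'
  rw [hb] at hjk
  by_cases hVj : V j k = ⊥
  · simp [hVj]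
  · rw [← EReal.coe_toReal (hVtop j k) hVj] at hjk ⊢
    norm_cast at hk' hjk ⊢
    linarith

/-- If a Hilbert ball of positive radius is contained in `Col(V)`,
then it is contained in a simplicial tropical cone generated by `n` columns of `V`. -/
theorem stmt6 {n p : ℕ} (V : Fin n → Fin p → EReal)
    (hVtop : ∀ i k, V i k ≠ ⊤)
    (hrow : ∀ i, ∃ k, V i k ≠ ⊥) (hcol : ∀ k, ∃ i, V i k ≠ ⊥)
    (a : Fin n → ℝ) (r : ℝ) (hr : 0 < r)
    (hball : ball (ofReal a) (r : EReal) ⊆ colSpace V) :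
    ∃ J : Finset (Fin p), J.card = n ∧
      ball (ofReal a) (r : EReal) ⊆ colSpaceJ V J ∧ Simplicial (colSpaceJ V J) := by
  choose k c hc hM using exists_dominant_col hVtop hr.le hball
  have hk : Function.Injective k := by
    intro j i hji
    by_contra hij
    have h1 := hM i j hij
    have h2 := hM j i (Ne.symm hij)
    rw [← hji, hc j] at h1
    rw [hji, hc i] at h2
    norm_cast at h1 h2
    linarith
  refine ⟨Finset.univ.image k, by simp [Finset.card_image_of_injective _ hk], ?_, ?_⟩
  · rw [colSpaceJ_image V hk]
    exact ball_subset_colSpace_of_dominant hc hM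
  · rw [colSpaceJ_image V hk]
    exact simplicial_of_dominant hr hc hM

end TropReg
end
end

section
/- Let x, a ∈ (Rmax)^n, both different from ⊥, and let i* be any index attaining max_{i∈[n]} (x_i + a_i). Then the Hilbert distance from x to the tropical hyperplane H_a satisfies dist_H(x, H_a) = (x_{i*} + a_{i*}) − max_{i ≠ i*} (x_i + a_i), with the conventions (−∞) − (−∞) = 0, r − (−∞) = +∞ for r ∈ R, and max over an empty set = −∞. -/
open scoped Classical BigOperators

noncomputable section

namespace TropReg

/-- Difference `s - t` in `EReal` with the conventions `(-∞) - (-∞) = 0` and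
`r - (-∞) = +∞` for real `r`. -/
def esub (s t : EReal) : EReal := if s = ⊥ ∧ t = ⊥ then 0 else s - t

theorem hd_self_nonpos {n : ℕ} (x : Fin n → EReal) : hd x x ≤ 0 := by
  unfold hd
  split_ifs with h
  · exact le_rfl
  · exact sInf_le ⟨0, 0, by simp, by simp, by simp⟩

theorem hd_nonneg {n : ℕ} {x : Fin n → EReal} (hx : IsRmax x) (hxb : x ≠ ⊥)
    (y : Fin n → EReal) : 0 ≤ hd x y := by
  unfold hd
  rw [if_neg (fun h => hxb h.1)]
  refine le_sInf ?_
  rintro t ⟨lam, mu, rfl, hmu, hlam⟩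
  obtain ⟨i, hi⟩ := Function.ne_iff.mp hxb
  have h1 := hmu i
  have h2 := hlam i
  have hxi := hx i
  simp only [Pi.bot_apply] at hi
  generalize x i = u at *
  generalize y i = v at *
  lift u to ℝ using ⟨hxi, hi⟩
  induction v with
  | bot => simp at h2
  | top => simp at h1
  | coe v =>
    norm_cast at h1 h2 ⊢
    linarith

/-- A point of the hyperplane of `a` attains its maximum away from any given index. -/
theorem exists_ne_forall_le_of_mem_hyper {n : ℕ} {a b : Fin n → EReal} (hb : b ∈ hyper a)
    (k : Fin n) : ∃ j, j ≠ k ∧ ∀ i, a i + b i ≤ a j + b j := by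
  obtain ⟨-, i, j, hij, hi, hj⟩ := hb
  by_cases h : i = k
  · refine ⟨j, fun hjk => hij (h.trans hjk.symm), fun l => ?_⟩
    rw [hj]
    exact le_iSup (fun k => a k + b k) l
  · refine ⟨i, h, fun l => ?_⟩
    rw [hi]
    exact le_iSup (fun k => a k + b k) l

/-- Two distinct indices attaining the maximum witness membership in the hyperplane. -/
theorem mem_hyper_of_forall_le {n : ℕ} {a b : Fin n → EReal} (hb : IsRmax b) {i j : Fin n}
    (hij : i ≠ j) (h : a i + b i = a j + b j) (hmax : ∀ k, a k + b k ≤ a i + b i) :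
    b ∈ hyper a := by
  have hi : a i + b i = ⨆ k, a k + b k :=
    le_antisymm (le_iSup (fun k => a k + b k) i) (iSup_le hmax)
  exact ⟨hb, i, j, hij, hi, h ▸ hi⟩

/-- If the maximum of `x + a` is finite, then any point of the hyperplane of `a` is at distance
at least the gap between this maximum and the second one. -/
theorem sub_le_hd_of_mem_hyper {n : ℕ} {x a b : Fin n → EReal} (hx : IsRmax x) (ha : IsRmax a)
    (hb : b ∈ hyper a) {k : Fin n} (hxk : x k ≠ ⊥) (hak : a k ≠ ⊥) :
    x k + a k - (⨆ i ∈ { i : Fin n | i ≠ k }, (x i + a i)) ≤ hd x b := by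
  unfold hd
  rw [if_neg (fun h => hxk (by rw [h.1]; rfl))]
  refine le_sInf ?_
  rintro t ⟨lam, mu, rfl, hmu, hlam⟩
  obtain ⟨j, hjk, hj⟩ := exists_ne_forall_le_of_mem_hyper hb k
  have hS : x j + a j ≤ ⨆ i ∈ { i : Fin n | i ≠ k }, (x i + a i) :=
    le_iSup₂ (f := fun i (_ : i ∈ { i : Fin n | i ≠ k }) => x i + a i) j hjk
  refine (EReal.sub_le_sub le_rfl hS).trans ?_
  have h1 := hlam k
  have h2 := hmu j
  have h3 := hj k
  have hbk := hb.1 k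
  have hbj := hb.1 j
  have hxk' := hx k
  have hak' := ha k
  have hxj := hx j
  have haj := ha j
  generalize x k = xk at *
  generalize a k = ak at *
  generalize b k = bk at *
  generalize x j = xj at *
  generalize a j = aj at *
  generalize b j = bj at *
  lift xk to ℝ using ⟨hxk', hxk⟩
  lift ak to ℝ using ⟨hak', hak⟩
  have hbk' : bk ≠ ⊥ := by rintro rfl; simp at h1
  lift bk to ℝ using ⟨hbk, hbk'⟩
  have haj' : aj ≠ ⊥ := by rintro rfl; simp [← EReal.coe_add] at h3
  lift aj to ℝ using ⟨haj, haj'⟩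
  have hbj' : bj ≠ ⊥ := by rintro rfl; simp [← EReal.coe_add] at h3
  lift bj to ℝ using ⟨hbj, hbj'⟩
  have hxj' : xj ≠ ⊥ := by rintro rfl; simp [← EReal.coe_add] at h2
  lift xj to ℝ using ⟨hxj, hxj'⟩
  norm_cast at *
  linarith

/-- Lowering the coordinate `k` of `x` until `x k + a k` meets the second maximum `x j + a j`
gives a point of the hyperplane of `a` at distance at most the gap. -/
theorem exists_mem_hyper_hd_le {n : ℕ} {x a : Fin n → EReal} (hx : IsRmax x) (ha : IsRmax a)
    {k j : Fin n} (hjk : j ≠ k) (hk : ∀ i, x i + a i ≤ x k + a k)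
    (hj : ∀ i, i ≠ k → x i + a i ≤ x j + a j) (hbot : x j + a j ≠ ⊥) :
    ∃ b ∈ hyper a, hd x b ≤ x k + a k - (x j + a j) := by
  obtain ⟨hxj, haj⟩ : x j ≠ ⊥ ∧ a j ≠ ⊥ := by simpa [EReal.add_eq_bot_iff] using hbot
  obtain ⟨hxk, hak⟩ : x k ≠ ⊥ ∧ a k ≠ ⊥ := by
    have : x k + a k ≠ ⊥ := fun h => hbot (le_bot_iff.mp (h ▸ hk j))
    simpa [EReal.add_eq_bot_iff] using this
  obtain ⟨u, hu⟩ : ∃ u : ℝ, x k = u := ⟨_, (EReal.coe_toReal (hx k) hxk).symm⟩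
  obtain ⟨c, hc⟩ : ∃ c : ℝ, a k = c := ⟨_, (EReal.coe_toReal (ha k) hak).symm⟩
  obtain ⟨v, hv⟩ : ∃ v : ℝ, x j = v := ⟨_, (EReal.coe_toReal (hx j) hxj).symm⟩
  obtain ⟨d, hd'⟩ : ∃ d : ℝ, a j = d := ⟨_, (EReal.coe_toReal (ha j) haj).symm⟩
  have hgap : v + d ≤ u + c := by
    have := hk j
    rw [hu, hc, hv, hd'] at this
    exact_mod_cast this
  obtain ⟨w, hw⟩ : ∃ w : ℝ, w = v + d - c := ⟨_, rfl⟩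
  have heq : a k + (w : EReal) = a j + x j := by
    rw [hc, hd', hv, hw]
    norm_cast
    ring
  refine ⟨Function.update x k (w : EReal), ?_, ?_⟩
  · refine mem_hyper_of_forall_le (fun i => ?_) hjk.symm ?_ fun i => ?_
    · by_cases h : i = k
      · subst h
        simp
      · simpa [h] using hx i
    · simpa [hjk] using heq
    · by_cases h : i = k
      · rw [h]
      · simpa [h, heq, add_comm] using hj i h
  · unfold hd
    rw [if_neg (fun h => hxk (by rw [h.1]; rfl))]
    refine sInf_le ⟨u + c - (v + d), 0, ?_, fun i => ?_, fun i => ?_⟩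
    · rw [hu, hc, hv, hd']
      norm_cast
      ring
    · by_cases h : i = k
      · subst h
        rw [Function.update_self, hu]
        norm_cast
        linarith
      · simp [h]
    · by_cases h : i = k
      · subst h
        rw [Function.update_self, hu]
        norm_cast
        linarith
      · rw [Function.update_of_ne h]
        exact le_add_of_nonneg_left (by exact_mod_cast sub_nonneg.mpr hgap)

theorem exists_ne_forall_le_of_iSup_ne_bot {n : ℕ} {f : Fin n → EReal} {k : Fin n}
    (h : (⨆ i ∈ { i : Fin n | i ≠ k }, f i) ≠ ⊥) :
    ∃ j, j ≠ k ∧ (⨆ i ∈ { i : Fin n | i ≠ k }, f i) = f j ∧ ∀ i, i ≠ k → f i ≤ f j := by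
  have hne : (Finset.univ.erase k).Nonempty := by
    by_contra hempty
    refine h (iSup₂_eq_bot.mpr fun i hi => absurd ⟨i, ?_⟩ hempty)
    simpa using hi
  obtain ⟨j, hj, hmax⟩ := Finset.exists_max_image _ f hne
  have hjk : j ≠ k := by simpa using hj
  have hle : ∀ i, i ≠ k → f i ≤ f j := fun i hi => hmax i (by simpa using hi)
  exact ⟨j, hjk, le_antisymm (iSup₂_le hle)
    (le_iSup₂ (f := fun i (_ : i ∈ { i : Fin n | i ≠ k }) => f i) j hjk), hle⟩

/-- For `x, a ∈ (Rmax)^n` different from `⊥` and `i*` attaining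
`max_i (x_i + a_i)`, the Hilbert distance from `x` to the tropical hyperplane `H_a`
is `(x_{i*} + a_{i*}) - max_{i ≠ i*} (x_i + a_i)`, with the conventions
`(-∞) - (-∞) = 0`, `r - (-∞) = +∞`, and `max ∅ = -∞`. -/
theorem stmt8 {n : ℕ} (x a : Fin n → EReal) (hx : IsRmax x) (ha : IsRmax a)
    (hxb : x ≠ ⊥) (hab : a ≠ ⊥) (istar : Fin n)
    (hstar : ∀ i, x i + a i ≤ x istar + a istar) :
    distPt x (hyper a) =
      esub (x istar + a istar) (⨆ i ∈ { i : Fin n | i ≠ istar }, (x i + a i)) := by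
  unfold distPt esub
  by_cases hM : x istar + a istar = ⊥
  · have hall : ∀ i, x i + a i = ⊥ := fun i => le_bot_iff.mp (hM ▸ hstar i)
    have hS : (⨆ i ∈ { i : Fin n | i ≠ istar }, (x i + a i)) = ⊥ := by simp [hall]
    rw [if_pos ⟨hM, hS⟩]
    obtain ⟨i, hi⟩ := Function.ne_iff.mp hxb
    obtain ⟨j, hj⟩ := Function.ne_iff.mp hab
    have hij : i ≠ j := by
      rintro rfl
      exact (EReal.add_eq_bot_iff.mp (hall i)).elim hi hj
    have hmem : x ∈ hyper a :=
      mem_hyper_of_forall_le hx hij (by rw [add_comm, hall, add_comm, hall])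
        fun k => by rw [add_comm, hall]; exact bot_le
    exact le_antisymm ((iInf₂_le x hmem).trans (hd_self_nonpos x))
      (le_iInf₂ fun b _ => hd_nonneg hx hxb b)
  · rw [if_neg fun h => hM h.1]
    obtain ⟨hxk, hak⟩ : x istar ≠ ⊥ ∧ a istar ≠ ⊥ := by simpa [EReal.add_eq_bot_iff] using hM
    refine le_antisymm ?_ (le_iInf₂ fun b hb => sub_le_hd_of_mem_hyper hx ha hb hxk hak)
    by_cases hS : (⨆ i ∈ { i : Fin n | i ≠ istar }, (x i + a i)) = ⊥
    · rw [hS, EReal.sub_bot hM]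
      exact le_top
    · obtain ⟨j, hjk, hSj, hj⟩ := exists_ne_forall_le_of_iSup_ne_bot hS
      rw [hSj] at hS ⊢
      obtain ⟨b, hb, hle⟩ := exists_mem_hyper_hd_le hx ha hjk hstar hj hS
      exact (iInf₂_le b hb).trans hle

end TropReg
end
end
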